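/- arXiv:2401.06218 — 6 statements merged into one kernel-verified Lean document; each statement's English description precedes it below -/
import Mathlib

section
/- Every chain complex of finitely generated free abelian groups decomposes, after a change of basis, into a free part with zero differential and two-step complexes: if M is a finitely generated free ℤ-module and d : M → M is a ℤ-linear endomorphism with d ∘ d = 0, then there exist natural numbers r and m, integers k₁, …, k_m, and a ℤ-module isomorphism φ : M ≅ ℤʳ ⊕ (ℤ²)ᵐ under which d corresponds to the endomorphism that is zero on the ℤʳ summand and that on the i-th summand ℤ² sends (a, b) to (0, kᵢ·a). -/
/-- Over a principal ideal domain, a square-zero endomorphism of a finite free module splits as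
a zero endomorphism and a direct sum of two-step complexes. -/
theorem LinearMap.exists_equiv_twoStep_of_comp_self_eq_zero {R M : Type*} [CommRing R] [IsDomain R]
    [IsPrincipalIdealRing R] [AddCommGroup M] [Module R M] [Module.Free R M] [Module.Finite R M]
    (d : M →ₗ[R] M) (hd : d ∘ₗ d = 0) :
    ∃ (r m : ℕ) (k : Fin m → R) (φ : M ≃ₗ[R] (Fin r → R) × (Fin m → R × R)),
      ∀ x : M, φ (d x) = (0, fun i => (0, k i * ((φ x).2 i).1)) := by
  classical
  obtain ⟨δ, hδ⟩ : ∃ δ : M →ₗ[R] LinearMap.ker d, ∀ x, (δ x : M) = d x :=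
    ⟨d.codRestrict (LinearMap.ker d) (LinearMap.congr_fun hd), fun _ => rfl⟩
  obtain ⟨m, snf⟩ := Submodule.smithNormalForm
    (Module.finBasis R (LinearMap.ker d)) (LinearMap.range δ)
  obtain ⟨s, hs⟩ := Module.projective_lifting_property δ.rangeRestrict LinearMap.id
    δ.surjective_rangeRestrict
  replace hs (y) : δ.rangeRestrict (s y) = y := LinearMap.congr_fun hs y
  have δ_ker (z : LinearMap.ker d) : δ (z : M) = 0 := Subtype.ext ((hδ z).trans z.2)
  let π : M →ₗ[R] LinearMap.ker d :=
    (LinearMap.id - s ∘ₗ δ.rangeRestrict).codRestrict _ fun x => by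
      have h : d (s (δ.rangeRestrict x)) = d x := by
        rw [← hδ, ← hδ]
        exact congrArg Subtype.val (congrArg Subtype.val (hs (δ.rangeRestrict x)))
      simp [h]
  have hπ (x) : (π x : M) = x - s (δ.rangeRestrict x) := rfl
  have range_ker (z : LinearMap.ker d) : δ.rangeRestrict (z : M) = 0 := Subtype.ext (δ_ker z)
  have π_ker (z : LinearMap.ker d) : π (z : M) = z :=
    Subtype.ext (by rw [hπ, range_ker, map_zero, sub_zero])
  let e := (Fintype.equivFin {j // j ∉ Set.range snf.f}).symm
  let φ : M →ₗ[R] (Fin _ → R) × (Fin m → R × R) :=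
    (LinearMap.pi fun i => snf.bM.coord (e i) ∘ₗ π).prod
      (LinearMap.pi fun i =>
        (snf.bN.coord i ∘ₗ δ.rangeRestrict).prod (snf.bM.coord (snf.f i) ∘ₗ π))
  have hφ (x) : φ x = (fun i => snf.bM.repr (π x) (e i),
      fun i => (snf.bN.repr (δ.rangeRestrict x) i, snf.bM.repr (π x) (snf.f i))) := rfl
  have φ_inj : Function.Injective φ := by
    rw [injective_iff_map_eq_zero]
    intro x hx
    simp only [hφ, Prod.ext_iff, funext_iff, Prod.fst_zero, Prod.snd_zero, Pi.zero_apply] at hx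
    have hN : δ.rangeRestrict x = 0 :=
      snf.bN.ext_elem fun i => by simpa using (hx.2 i).1
    have hK : π x = 0 := snf.bM.ext_elem fun j => by
      by_cases hj : j ∈ Set.range snf.f
      · obtain ⟨i, rfl⟩ := hj
        simpa using (hx.2 i).2
      · simpa using hx.1 (e.symm ⟨j, hj⟩)
    simpa [hN, hK] using (hπ x).symm
  have φ_surj : Function.Surjective φ := by
    rintro ⟨u, v⟩
    let y := snf.bN.equivFun.symm fun i => (v i).1
    let z := snf.bM.equivFun.symm fun j =>
      if h : j ∈ Set.range snf.f then (v h.choose).2 else u (e.symm ⟨j, h⟩)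
    have hz (j) : snf.bM.repr z j =
        if h : j ∈ Set.range snf.f then (v h.choose).2 else u (e.symm ⟨j, h⟩) :=
      congrFun (snf.bM.equivFun.apply_symm_apply _) j
    have hy (i) : snf.bN.repr y i = (v i).1 :=
      congrFun (snf.bN.equivFun.apply_symm_apply _) i
    have hdx : δ.rangeRestrict (z + s y) = y := by rw [map_add, range_ker, hs, zero_add]
    have hπx : π (z + s y) = z := Subtype.ext (by rw [hπ, hdx, add_sub_cancel_right])
    refine ⟨z + s y, ?_⟩
    rw [hφ, hdx, hπx]
    refine Prod.ext (funext fun i => ?_) (funext fun i => Prod.ext (hy i) ?_)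
    · simp only [hz]
      rw [dif_neg (e i).2, Subtype.coe_eta, e.symm_apply_apply]
    · have h : snf.f i ∈ Set.range snf.f := ⟨i, rfl⟩
      simp only [hz]
      rw [dif_pos h, snf.f.injective h.choose_spec]
  refine ⟨_, m, snf.a, LinearEquiv.ofBijective φ ⟨φ_inj, φ_surj⟩, fun x => ?_⟩
  change φ (d x) = (0, fun i => (0, snf.a i * ((φ x).2 i).1))
  rw [hφ, hφ, ← hδ, π_ker, range_ker]
  refine Prod.ext (funext fun i => ?_) (funext fun i => Prod.ext (by simp) ?_)
  · exact snf.repr_eq_zero_of_notMem_range (δ.rangeRestrict x) (e i).2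
  · exact (snf.repr_apply_embedding_eq_repr_smul (m := δ.rangeRestrict x)).trans (by simp)

/-- Every chain complex of finitely generated free abelian groups
decomposes, after a change of basis, into a free part with zero differential and
two-step complexes `ℤ →^{kᵢ} ℤ`: if `M` is a finitely generated free `ℤ`-module and
`d : M → M` is `ℤ`-linear with `d ∘ d = 0`, then there are `r m : ℕ`, integers
`k : Fin m → ℤ`, and an isomorphism `φ : M ≅ ℤʳ ⊕ (ℤ²)ᵐ` under which `d` corresponds to
the endomorphism vanishing on `ℤʳ` and sending `(a, b)` to `(0, kᵢ · a)` on the `i`-th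
summand `ℤ²`. -/
theorem stmt_9 (M : Type*) [AddCommGroup M] [Module ℤ M]
    [Module.Free ℤ M] [Module.Finite ℤ M]
    (d : M →ₗ[ℤ] M) (hd : d ∘ₗ d = 0) :
    ∃ (r m : ℕ) (k : Fin m → ℤ) (φ : M ≃ₗ[ℤ] (Fin r → ℤ) × (Fin m → ℤ × ℤ)),
      ∀ x : M, φ (d x) = (0, fun i => (0, k i * ((φ x).2 i).1)) := by
  exact d.exists_equiv_twoStep_of_comp_self_eq_zero hd
end

section
/- The Maslov index of any domain between two grid states is an integer: for every n ≥ 2, every pair of grid states x, y in the toroidal grid of size n, and every domain D from x to y, the rational number μ(D) (the total point measure of D at the points of x and of y) lies in ℤ. -/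
/-- `D : (ℤ/n)² → ℤ` is a domain from the grid state `σ` to the grid state `τ`:
for all `(i,j)`, `D(i,j) − D(i−1,j) − D(i,j−1) + D(i−1,j−1) = 𝟙[j = σ i] − 𝟙[j = τ i]`. -/
def IsGridDomain (n : ℕ) (σ τ : Equiv.Perm (ZMod n)) (D : ZMod n → ZMod n → ℤ) : Prop :=
  ∀ i j : ZMod n,
    D i j - D (i - 1) j - D i (j - 1) + D (i - 1) (j - 1) =
      (if j = σ i then 1 else 0) - (if j = τ i then 1 else 0)

/-- The point measure of `D` at the point `(i,j)`: the average of the values of `D`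
on the four squares meeting at `(i,j)`. -/
def ptMeasure (n : ℕ) (D : ZMod n → ZMod n → ℤ) (i j : ZMod n) : ℚ :=
  ((D i j + D (i - 1) j + D i (j - 1) + D (i - 1) (j - 1) : ℤ) : ℚ) / 4

/-- The Maslov index of a domain `D` from `σ` to `τ`: the sum of the point measures of
`D` at all points of `σ` and all points of `τ`. -/
def maslov (n : ℕ) [NeZero n] (σ τ : Equiv.Perm (ZMod n))
    (D : ZMod n → ZMod n → ℤ) : ℚ :=
  (∑ i : ZMod n, ptMeasure n D i (σ i)) + ∑ i : ZMod n, ptMeasure n D i (τ i)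

namespace GridDomain

/-- The sum of the values of `D` on the four squares meeting at `(i,j)`. -/
def squareSum {n : ℕ} (D : ZMod n → ZMod n → ℤ) (i j : ZMod n) : ℤ :=
  D i j + D (i - 1) j + D i (j - 1) + D (i - 1) (j - 1)

/-- The indicator of `k ≤ i` for the representatives in `{0, …, n - 1}`. -/
def leInd {n : ℕ} (i k : ZMod n) : ℤ := if k.val ≤ i.val then 1 else 0

/-- The indicator of `k < i` for the representatives in `{0, …, n - 1}`. -/
def ltInd {n : ℕ} (i k : ZMod n) : ℤ := if k.val < i.val then 1 else 0

/-- The sign of `i - k` for the representatives in `{0, …, n - 1}`. -/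
def ordSign {n : ℕ} (i k : ZMod n) : ℤ := ltInd i k - ltInd k i

/-- The domain from `σ` to `τ` that counts the points of `σ` minus the points of `τ`
in the lower left quadrant of a square. -/
def quadrantDomain {n : ℕ} [NeZero n] (σ τ : Equiv.Perm (ZMod n)) (i j : ZMod n) : ℤ :=
  ∑ k, leInd i k * (leInd j (σ k) - leInd j (τ k))

lemma leInd_eq {n : ℕ} [NeZero n] (i k : ZMod n) :
    leInd i k = ltInd i k + if k = i then 1 else 0 := by
  have h : k = i ↔ k.val = i.val := (ZMod.val_injective n).eq_iff.symm
  simp only [leInd, ltInd, h]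
  grind

lemma val_sub_one_of_ne_zero {n : ℕ} [NeZero n] {i : ZMod n} (hi : i ≠ 0) :
    (i - 1).val = i.val - 1 := by
  have hpos : 0 < i.val := Nat.pos_of_ne_zero (by simpa using hi)
  have hlt := ZMod.val_lt i
  have h : i - 1 = ((i.val - 1 : ℕ) : ZMod n) := by
    rw [Nat.cast_sub (by omega)]
    simp
  rw [h, ZMod.val_natCast, Nat.mod_eq_of_lt (by omega)]

lemma val_zero_sub_one {n : ℕ} [NeZero n] : ((0 : ZMod n) - 1).val = n - 1 := by
  have hn := NeZero.pos n
  have h : (0 : ZMod n) - 1 = ((n - 1 : ℕ) : ZMod n) := by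
    rw [Nat.cast_sub (by omega)]
    simp
  rw [h, ZMod.val_natCast, Nat.mod_eq_of_lt (by omega)]

lemma leInd_sub_one {n : ℕ} [NeZero n] (i k : ZMod n) :
    leInd (i - 1) k = ltInd i k + if i = 0 then 1 else 0 := by
  have hk := ZMod.val_lt k
  by_cases hi : i = 0
  · subst hi
    simp only [leInd, ltInd, val_zero_sub_one, ZMod.val_zero]
    grind
  · have hpos : 0 < i.val := Nat.pos_of_ne_zero (by simpa using hi)
    simp only [leInd, ltInd, val_sub_one_of_ne_zero hi, hi]
    grind

lemma leInd_add_ltInd {n : ℕ} (i k : ZMod n) : leInd i k + ltInd i k = 1 + ordSign i k := by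
  simp only [leInd, ordSign, ltInd]
  grind

lemma sum_perm_sub {n : ℕ} [NeZero n] (σ τ : Equiv.Perm (ZMod n)) (f : ZMod n → ℤ) :
    ∑ k, (f (σ k) - f (τ k)) = 0 := by
  rw [Finset.sum_sub_distrib, Equiv.sum_comp σ f, Equiv.sum_comp τ f, sub_self]

lemma quadrantDomain_sub_one_left {n : ℕ} [NeZero n] (σ τ : Equiv.Perm (ZMod n))
    (i j : ZMod n) :
    quadrantDomain σ τ (i - 1) j = ∑ k, ltInd i k * (leInd j (σ k) - leInd j (τ k)) := by
  simp only [quadrantDomain, leInd_sub_one i, add_mul, Finset.sum_add_distrib,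
    ← Finset.mul_sum, sum_perm_sub, mul_zero, add_zero]

lemma leInd_sub_one_sub {n : ℕ} [NeZero n] (j a b : ZMod n) :
    leInd (j - 1) a - leInd (j - 1) b = ltInd j a - ltInd j b := by
  simp only [leInd_sub_one]
  ring

lemma isGridDomain_quadrantDomain {n : ℕ} [NeZero n] (σ τ : Equiv.Perm (ZMod n)) :
    IsGridDomain n σ τ (quadrantDomain σ τ) := by
  intro i j
  have key : ∑ k, (if k = i then 1 else 0) *
      (((if σ k = j then 1 else 0) - (if τ k = j then 1 else 0)) : ℤ) =
      (if j = σ i then 1 else 0) - (if j = τ i then 1 else 0) := by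
    simp [eq_comm]
  rw [← key]
  simp only [quadrantDomain_sub_one_left]
  simp only [quadrantDomain, leInd_sub_one_sub]
  simp only [leInd_eq]
  rw [← Finset.sum_sub_distrib, ← Finset.sum_sub_distrib, ← Finset.sum_add_distrib]
  refine Finset.sum_congr rfl fun k _ => ?_
  ring

lemma squareSum_quadrantDomain {n : ℕ} [NeZero n] (σ τ : Equiv.Perm (ZMod n))
    (i j : ZMod n) :
    squareSum (quadrantDomain σ τ) i j =
      ∑ k, ordSign i k * (ordSign j (σ k) - ordSign j (τ k)) := by
  have h : squareSum (quadrantDomain σ τ) i j =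
      ∑ k, (1 + ordSign i k) * (ordSign j (σ k) - ordSign j (τ k)) := by
    simp only [squareSum, quadrantDomain_sub_one_left]
    simp only [quadrantDomain, leInd_sub_one_sub]
    rw [← Finset.sum_add_distrib, ← Finset.sum_add_distrib, ← Finset.sum_add_distrib]
    refine Finset.sum_congr rfl fun k _ => ?_
    linear_combination (leInd j (σ k) + ltInd j (σ k) - leInd j (τ k) - ltInd j (τ k)) *
      leInd_add_ltInd i k + (1 + ordSign i k) * (leInd_add_ltInd j (σ k) -
      leInd_add_ltInd j (τ k))
  rw [h]
  simp only [add_mul, one_mul, Finset.sum_add_distrib, sum_perm_sub, zero_add]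

lemma ordSign_antisymm {n : ℕ} (i k : ZMod n) : ordSign k i = -ordSign i k := by
  simp [ordSign]

lemma sum_ordSign_mul_perm {n : ℕ} [NeZero n] (σ : Equiv.Perm (ZMod n)) :
    ∑ i, ∑ k, ordSign i k * ordSign (σ i) (σ k) =
      2 * ∑ i, ∑ k, ltInd i k * ordSign (σ i) (σ k) := by
  have h : ∑ i, ∑ k, ltInd k i * ordSign (σ i) (σ k) =
      -∑ i, ∑ k, ltInd i k * ordSign (σ i) (σ k) := by
    rw [Finset.sum_comm]
    simp only [← Finset.sum_neg_distrib]
    refine Finset.sum_congr rfl fun i _ => Finset.sum_congr rfl fun k _ => ?_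
    rw [ordSign_antisymm (σ i) (σ k)]
    ring
  simp only [ordSign] at h ⊢
  simp only [sub_mul (ltInd _ _), Finset.sum_sub_distrib, h]
  ring

lemma two_dvd_ltInd_mul {n : ℕ} [NeZero n] (σ τ : Equiv.Perm (ZMod n)) (i k : ZMod n) :
    (2 : ℤ) ∣ ltInd i k * ordSign (σ i) (σ k) - ltInd i k * ordSign (τ i) (τ k) := by
  by_cases hik : i = k
  · subst hik
    simp [ltInd]
  · have hσ : (σ i).val ≠ (σ k).val := fun h => hik (σ.injective (ZMod.val_injective n h))
    have hτ : (τ i).val ≠ (τ k).val := fun h => hik (τ.injective (ZMod.val_injective n h))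
    rw [← mul_sub]
    refine Dvd.dvd.mul_left ?_ _
    simp only [ordSign, ltInd]
    split_ifs <;> omega

lemma four_dvd_quadrantDomain {n : ℕ} [NeZero n] (σ τ : Equiv.Perm (ZMod n)) :
    (4 : ℤ) ∣ ∑ i, squareSum (quadrantDomain σ τ) i (σ i) +
      ∑ i, squareSum (quadrantDomain σ τ) i (τ i) := by
  have hcross : ∑ i, ∑ k, ordSign i k * ordSign (τ i) (σ k) =
      ∑ i, ∑ k, ordSign i k * ordSign (σ i) (τ k) := by
    rw [Finset.sum_comm]
    refine Finset.sum_congr rfl fun i _ => Finset.sum_congr rfl fun k _ => ?_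
    rw [ordSign_antisymm i k, ordSign_antisymm (σ i) (τ k)]
    ring
  have htotal : ∑ i, squareSum (quadrantDomain σ τ) i (σ i) +
      ∑ i, squareSum (quadrantDomain σ τ) i (τ i) =
      2 * ∑ i, ∑ k, (ltInd i k * ordSign (σ i) (σ k) - ltInd i k * ordSign (τ i) (τ k)) := by
    simp only [squareSum_quadrantDomain, mul_sub, Finset.sum_sub_distrib, hcross,
      sum_ordSign_mul_perm]
    ring
  rw [htotal]
  exact mul_dvd_mul_left 2
    (Finset.dvd_sum fun i _ => Finset.dvd_sum fun k _ => two_dvd_ltInd_mul σ τ i k)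

lemma eq_apply_zero_of_sub_one {n : ℕ} [NeZero n] {f : ZMod n → ℤ}
    (hf : ∀ i, f i = f (i - 1)) (i : ZMod n) : f i = f 0 := by
  have h : ∀ m : ℕ, f (m : ZMod n) = f 0 := by
    intro m
    induction m with
    | zero => simp
    | succ m ih => rw [hf, Nat.cast_succ, add_sub_cancel_right, ih]
  simpa using h i.val

lemma eq_add_of_mixed_difference_eq_zero {n : ℕ} [NeZero n] {E : ZMod n → ZMod n → ℤ}
    (hE : ∀ i j, E i j - E (i - 1) j - E i (j - 1) + E (i - 1) (j - 1) = 0)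
    (i j : ZMod n) : E i j = E i 0 + (E 0 j - E 0 0) := by
  have hcol (i j : ZMod n) : E i j - E (i - 1) j = E i 0 - E (i - 1) 0 :=
    eq_apply_zero_of_sub_one (f := fun j => E i j - E (i - 1) j)
      (fun j => by linarith [hE i j]) j
  have hrow : E i j - E i 0 = E 0 j - E 0 0 :=
    eq_apply_zero_of_sub_one (f := fun i => E i j - E i 0)
      (fun i => by linarith [hcol i j]) i
  linarith

lemma four_dvd_of_mixed_difference_eq_zero {n : ℕ} [NeZero n] {E : ZMod n → ZMod n → ℤ}
    (hE : ∀ i j, E i j - E (i - 1) j - E i (j - 1) + E (i - 1) (j - 1) = 0)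
    (σ : Equiv.Perm (ZMod n)) : (4 : ℤ) ∣ ∑ i, squareSum E i (σ i) := by
  set g : ZMod n → ℤ := fun j => E 0 j - E 0 0 with hg
  have hsq (i j : ZMod n) :
      squareSum E i j = 2 * (E i 0 + E (i - 1) 0) + 2 * (g j + g (j - 1)) := by
    have h := eq_add_of_mixed_difference_eq_zero hE
    simp only [squareSum, hg]
    linarith [h i j, h (i - 1) j, h i (j - 1), h (i - 1) (j - 1)]
  have hshift (f : ZMod n → ℤ) : ∑ i, f (i - 1) = ∑ i, f i :=
    Equiv.sum_comp (Equiv.subRight (1 : ZMod n)) f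
  have hσ : ∑ i, (g (σ i) + g (σ i - 1)) = ∑ i, (g i + g (i - 1)) :=
    Equiv.sum_comp σ fun j => g j + g (j - 1)
  refine ⟨∑ i, E i 0 + ∑ i, g i, ?_⟩
  simp only [hsq]
  rw [Finset.sum_add_distrib, ← Finset.mul_sum, ← Finset.mul_sum, hσ,
    Finset.sum_add_distrib, Finset.sum_add_distrib, hshift g, hshift fun i => E i 0]
  ring

lemma four_dvd_squareSum {n : ℕ} [NeZero n] {σ τ : Equiv.Perm (ZMod n)}
    {D : ZMod n → ZMod n → ℤ} (hD : IsGridDomain n σ τ D) :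
    (4 : ℤ) ∣ ∑ i, squareSum D i (σ i) + ∑ i, squareSum D i (τ i) := by
  have hE (i j : ZMod n) := (hD i j).trans (isGridDomain_quadrantDomain σ τ i j).symm
  set E : ZMod n → ZMod n → ℤ := fun i j => D i j - quadrantDomain σ τ i j with hEdef
  have hE' : ∀ i j, E i j - E (i - 1) j - E i (j - 1) + E (i - 1) (j - 1) = 0 := by
    intro i j
    simp only [hEdef]
    linarith [hE i j]
  have hsq (i j : ZMod n) :
      squareSum D i j = squareSum E i j + squareSum (quadrantDomain σ τ) i j := by
    simp only [squareSum, hEdef]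
    ring
  have h := dvd_add (dvd_add (four_dvd_of_mixed_difference_eq_zero hE' σ)
    (four_dvd_of_mixed_difference_eq_zero hE' τ)) (four_dvd_quadrantDomain σ τ)
  simp only [hsq, Finset.sum_add_distrib]
  rw [add_add_add_comm]
  simpa only [add_assoc] using h

end GridDomain

/-- The Maslov index of any domain between two grid states is an
integer. -/
theorem stmt_10 (n : ℕ) [NeZero n] (hn : 2 ≤ n) (σ τ : Equiv.Perm (ZMod n))
    (D : ZMod n → ZMod n → ℤ) (hD : IsGridDomain n σ τ D) :
    ∃ z : ℤ, maslov n σ τ D = z := by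
  obtain ⟨z, hz⟩ := GridDomain.four_dvd_squareSum hD
  refine ⟨z, ?_⟩
  have hz' : ((∑ i, GridDomain.squareSum D i (σ i) +
      ∑ i, GridDomain.squareSum D i (τ i) : ℤ) : ℚ) = 4 * z := by
    rw [hz]
    push_cast
    ring
  have hpt (i j : ZMod n) : ptMeasure n D i j = (GridDomain.squareSum D i j : ℚ) / 4 := rfl
  simp only [maslov, hpt, ← Finset.sum_div]
  push_cast at hz'
  linarith
end

section
/- For every n ≥ 2, grid states x, y, and every rectangle R from x to y in the toroidal grid of size n, the Maslov index of R equals 1 + 2k, where k is the number of points of x lying in the interior of R. In particular, a rectangle has Maslov index 1 if and only if it is empty. -/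
/-- A cyclic interval `{a, a+1, …, a+k}` in `ℤ/n` (nonempty by construction). -/
def IsCyclicInterval (n : ℕ) (S : Set (ZMod n)) : Prop :=
  ∃ (a : ZMod n) (k : ℕ), S = {b | ∃ m : ℕ, m ≤ k ∧ b = a + (m : ZMod n)}

/-- A rectangle from `σ` to `τ`: a domain from `σ` to `τ` which is the indicator
function of a product `I × J` of nonempty proper cyclic intervals in `ℤ/n`. -/
def IsRectangle (n : ℕ) (σ τ : Equiv.Perm (ZMod n)) (D : ZMod n → ZMod n → ℤ) : Prop :=
  IsGridDomain n σ τ D ∧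
    ∃ I J : Set (ZMod n),
      IsCyclicInterval n I ∧ IsCyclicInterval n J ∧ I ≠ Set.univ ∧ J ≠ Set.univ ∧
      ∀ i j : ZMod n, D i j = (I ×ˢ J).indicator 1 (i, j)

/-- The point `(i,j)` lies in the interior of the rectangle `D`: all four squares
`(i,j)`, `(i−1,j)`, `(i,j−1)`, `(i−1,j−1)` lie in the product `I × J`, i.e. `D` takes
the value `1` on all four of them. -/
def InInterior (n : ℕ) (D : ZMod n → ZMod n → ℤ) (i j : ZMod n) : Prop :=
  D i j = 1 ∧ D (i - 1) j = 1 ∧ D i (j - 1) = 1 ∧ D (i - 1) (j - 1) = 1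

/-- An empty rectangle from `σ` to `τ`: a rectangle containing no point of `σ` in its
interior. -/
def IsEmptyRectangle (n : ℕ) (σ τ : Equiv.Perm (ZMod n))
    (D : ZMod n → ZMod n → ℤ) : Prop :=
  IsRectangle n σ τ D ∧ ∀ i : ZMod n, ¬ InInterior n D i (σ i)

/-- A proper cyclic interval has exactly two boundary points: its first element `a` and the
successor `b` of its last element. -/
lemma IsCyclicInterval.exists_boundary {n : ℕ} [NeZero n] {S : Set (ZMod n)}
    (hS : IsCyclicInterval n S) (hne : S ≠ Set.univ) :
    ∃ a b : ZMod n, a ≠ b ∧ a ∈ S ∧ a - 1 ∉ S ∧ b ∉ S ∧ b - 1 ∈ S ∧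
      ∀ i, i ≠ a → i ≠ b → (i ∈ S ↔ i - 1 ∈ S) := by
  obtain ⟨a, k, rfl⟩ := hS
  have hk : k + 1 < n := by
    by_contra! h
    refine hne (Set.eq_univ_of_forall fun b => ⟨(b - a).val, ?_, by simp⟩)
    have := ZMod.val_lt (b - a)
    omega
  have hcast : ∀ m : ℕ, 0 < m → m < n → (m : ZMod n) ≠ 0 := fun m h0 hm h =>
    absurd (Nat.le_of_dvd h0 ((ZMod.natCast_eq_zero_iff m n).1 h)) (by omega)
  have ha : a ∈ {b | ∃ m : ℕ, m ≤ k ∧ b = a + (m : ZMod n)} := ⟨0, by simp, by simp⟩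
  have hb : a + ((k + 1 : ℕ) : ZMod n) ∉ {b | ∃ m : ℕ, m ≤ k ∧ b = a + (m : ZMod n)} := by
    rintro ⟨m, hm, h⟩
    refine hcast (k + 1 - m) (by omega) (by omega) ?_
    rw [Nat.cast_sub (by omega), ← add_left_cancel h, sub_self]
  refine ⟨a, a + ((k + 1 : ℕ) : ZMod n), fun h => hb (h ▸ ha), ha, ?_, hb,
    ⟨k, le_rfl, by push_cast; ring⟩, fun i hia hib => ⟨?_, ?_⟩⟩
  · rintro ⟨m, hm, h⟩
    refine hcast (m + 1) (by omega) (by omega) ?_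
    push_cast
    linear_combination -h
  · rintro ⟨m, hm, rfl⟩
    obtain _ | m := m
    · simp at hia
    · exact ⟨m, by omega, by push_cast; ring⟩
  · rintro ⟨m, hm, h⟩
    have hi : i = a + ((m + 1 : ℕ) : ZMod n) := by
      push_cast
      linear_combination h
    refine ⟨m + 1, ?_, hi⟩
    by_contra! hlt
    obtain rfl : m = k := by omega
    exact hib hi

/-- The corners of a rectangle each contribute `1/4` to the Maslov index and every other row
contributes `2` or `0`, according to whether its point is interior. -/
lemma IsRectangle.exists_ptMeasure_add {n : ℕ} [NeZero n] {σ τ : Equiv.Perm (ZMod n)}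
    {R : ZMod n → ZMod n → ℤ} (hR : IsRectangle n σ τ R) [∀ i, Decidable (InInterior n R i (σ i))] :
    ∃ a b : ZMod n, ∀ i, ptMeasure n R i (σ i) + ptMeasure n R i (τ i) =
      (if i = a then 1 / 2 else 0) + (if i = b then 1 / 2 else 0) +
        2 * (if InInterior n R i (σ i) then 1 else 0) := by
  classical
  obtain ⟨hD, I, J, hI, hJ, hI', hJ', h⟩ := hR
  obtain ⟨a, b, hab, ha, ha', hb, hb', hi⟩ := hI.exists_boundary hI'
  obtain ⟨c, d, hcd, hc, hc', hd, hd', hj⟩ := hJ.exists_boundary hJ'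
  have h' : ∀ i j, R i j = if i ∈ I ∧ j ∈ J then 1 else 0 := fun i j => by
    simp [h, Set.indicator_apply]
  have hac : c = σ a := by
    have := hD a c
    simp only [h', ha, ha', hc, hc'] at this
    grind
  have had : d = τ a := by
    have := hD a d
    simp only [h', ha, ha', hd, hd'] at this
    grind
  have hbc : c = τ b := by
    have := hD b c
    simp only [h', hb, hb', hc, hc'] at this
    grind
  have hbd : d = σ b := by
    have := hD b d
    simp only [h', hb, hb', hd, hd'] at this
    grind
  refine ⟨a, b, fun i => ?_⟩
  by_cases hia : i = a
  · subst hia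
    simp only [ptMeasure, InInterior, ← hac, ← had, h', ha, ha', hc, hc', hd, hd', hab]
    norm_num
  by_cases hib : i = b
  · subst hib
    simp only [ptMeasure, InInterior, ← hbc, ← hbd, h', hb, hb', hc, hc', hd, hd', hia]
    norm_num
  have hστ : σ i = τ i := by
    have := hD i (σ i)
    simp only [h', hi i hia hib] at this
    grind
  have hσc : σ i ≠ c := fun e => hia (σ.injective (e.trans hac))
  have hσd : σ i ≠ d := fun e => hib (σ.injective (e.trans hbd))
  simp only [ptMeasure, InInterior, ← hστ, h', hi i hia hib, hj _ hσc hσd, hia, hib]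
  split_ifs <;> simp_all
  norm_num

/-- For every rectangle `R` from a grid state `x` (given by `σ`) to a grid
state `y` (given by `τ`), the Maslov index of `R` equals `1 + 2k`, where `k` is the
number of points of `x` in the interior of `R`; in particular, `μ(R) = 1` if and only
if `R` is empty. -/
theorem stmt_11 (n : ℕ) [NeZero n] (hn : 2 ≤ n) (σ τ : Equiv.Perm (ZMod n))
    (R : ZMod n → ZMod n → ℤ) (hR : IsRectangle n σ τ R) :
    maslov n σ τ R = 1 + 2 * (Nat.card {i : ZMod n // InInterior n R i (σ i)} : ℚ) ∧
    (maslov n σ τ R = 1 ↔ IsEmptyRectangle n σ τ R) := by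
  classical
  have key : maslov n σ τ R =
      1 + 2 * (Nat.card {i : ZMod n // InInterior n R i (σ i)} : ℚ) := by
    obtain ⟨a, b, h⟩ := hR.exists_ptMeasure_add
    rw [maslov, ← Finset.sum_add_distrib, Finset.sum_congr rfl fun i _ => h i,
      Finset.sum_add_distrib, Finset.sum_add_distrib, ← Finset.mul_sum, Finset.sum_boole,
      Nat.card_eq_fintype_card, Fintype.card_subtype]
    simp only [Finset.sum_ite_eq', Finset.mem_univ, if_true]
    norm_num
  refine ⟨key, ?_⟩
  rw [key, IsEmptyRectangle, and_iff_right hR]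
  simp [Fintype.card_eq_zero_iff, isEmpty_subtype]
end

section
/- Every positive domain of Maslov index 2 connecting two distinct grid states decomposes as a concatenation of two rectangles in exactly two ways: for n ≥ 2, if x ≠ y are grid states in the toroidal grid of size n and D is a positive domain from x to y with μ(D) = 2, then there are exactly two triples (w, R₁, R₂) where w is a grid state, R₁ is a rectangle from x to w, R₂ is a rectangle from w to y, and D = R₁ + R₂. -/
/-- The indicator function of the half-open cyclic interval `[a, b)` in `ℤ/n`
(empty when `a = b`). -/
def cycInd {n : ℕ} (a b i : ZMod n) : ℤ := if (i - a).val < (b - a).val then 1 else 0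

section CyclicIntervals

variable {n : ℕ}

theorem val_sub_eq_zero_iff (p q : ZMod n) : (p - q).val = 0 ↔ p = q := by
  rw [ZMod.val_eq_zero, sub_eq_zero]

theorem cycInd_eq_zero_or_one (a b i : ZMod n) : cycInd a b i = 0 ∨ cycInd a b i = 1 := by
  unfold cycInd; split_ifs <;> simp

theorem cycInd_nonneg (a b i : ZMod n) : 0 ≤ cycInd a b i := by
  rcases cycInd_eq_zero_or_one a b i with h | h <;> simp [h]

theorem cycInd_self_right (a b : ZMod n) : cycInd a b b = 0 := by
  simp [cycInd]

variable [NeZero n]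

theorem val_sub_eq_ite (p q : ZMod n) :
    (p - q).val = if q.val ≤ p.val then p.val - q.val else n + p.val - q.val := by
  have h := ZMod.val_add (p - q) q
  rw [sub_add_cancel] at h
  have h1 := ZMod.val_lt (p - q)
  have h2 := ZMod.val_lt q
  have h3 := ZMod.val_lt p
  rcases lt_or_ge ((p - q).val + q.val) n with h4 | h4
  · rw [Nat.mod_eq_of_lt h4] at h
    split_ifs <;> omega
  · rw [Nat.mod_eq_sub_mod h4, Nat.mod_eq_of_lt (by omega)] at h
    split_ifs <;> omega

theorem val_sub_inj (a p q : ZMod n) : (p - a).val = (q - a).val ↔ p = q := by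
  rw [(ZMod.val_injective n).eq_iff, sub_left_inj]

omit [NeZero n] in
theorem cycInd_self_left {a b : ZMod n} (h : a ≠ b) : cycInd a b a = 1 := by
  have := (val_sub_eq_zero_iff b a).not.2 h.symm
  have h0 : (a - a).val = 0 := by simp
  unfold cycInd
  rw [if_pos (by omega)]

/-- The indicator of `[a, b)` jumps up at `a` and down at `b`. -/
theorem cycInd_sub_pred (a b i : ZMod n) :
    cycInd a b i - cycInd a b (i - 1) = (if i = a then 1 else 0) - (if i = b then 1 else 0) := by
  rcases Nat.lt_or_ge 1 n with hn | hn
  · have e : i - 1 - a = (i - a) - 1 := by ring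
    have h1 := val_sub_eq_ite (i - a) 1
    have : Fact (1 < n) := ⟨hn⟩
    rw [ZMod.val_one] at h1
    have hia := val_sub_eq_zero_iff i a
    have hib := val_sub_inj a i b
    have := ZMod.val_lt (i - a)
    have := ZMod.val_lt (b - a)
    unfold cycInd
    rw [e, h1]
    simp only [← hia, ← hib]
    split_ifs <;> omega
  · have hn1 : n = 1 := by have := NeZero.ne n; omega
    subst hn1
    simp [Subsingleton.elim i a, Subsingleton.elim b a, Subsingleton.elim (a - 1) a]

theorem cycInd_pred_of_ne {a b i : ZMod n} (ha : i ≠ a) (hb : i ≠ b) :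
    cycInd a b (i - 1) = cycInd a b i := by
  have := cycInd_sub_pred a b i
  simp only [ha, hb, if_false] at this
  omega

theorem cycInd_add_cycInd_swap {a b : ZMod n} (h : a ≠ b) (i : ZMod n) :
    cycInd a b i + cycInd b a i = 1 := by
  have e1 := val_sub_eq_ite (i - a) (b - a)
  have e2 := val_sub_eq_ite (a - a) (b - a)
  rw [sub_sub_sub_cancel_right] at e1 e2
  have h0 : (a - a).val = 0 := by simp
  have := (val_sub_eq_zero_iff b a).not.2 h.symm
  have := ZMod.val_lt (i - a)
  have := ZMod.val_lt (b - a)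
  unfold cycInd
  rw [e1, e2, h0]
  split_ifs <;> omega

/-- The points `x`, `y`, `z` are distinct and met in this cyclic order. -/
structure CycOrd (x y z : ZMod n) : Prop where
  ne₁₂ : x ≠ y
  ne₂₃ : y ≠ z
  ne₁₃ : x ≠ z
  split : ∀ i, cycInd x z i = cycInd x y i + cycInd y z i

theorem CycOrd.rotate {x y z : ZMod n} (h : CycOrd x y z) : CycOrd y z x where
  ne₁₂ := h.ne₂₃
  ne₂₃ := h.ne₁₃.symm
  ne₁₃ := h.ne₁₂.symm
  split i := by
    have h1 := cycInd_add_cycInd_swap h.ne₁₂ i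
    have h2 := cycInd_add_cycInd_swap h.ne₁₃ i
    have h3 := h.split i
    omega

theorem cycOrd_or_cycOrd {x y z : ZMod n} (hxy : x ≠ y) (hyz : y ≠ z) (hxz : x ≠ z) :
    CycOrd x y z ∨ CycOrd x z y := by
  have hyx := (val_sub_eq_zero_iff y x).not.2 hxy.symm
  have hzx := (val_sub_eq_zero_iff z x).not.2 hxz.symm
  have hzy := (val_sub_inj x y z).not.2 hyz
  have ly := ZMod.val_lt (y - x)
  have lz := ZMod.val_lt (z - x)
  rcases Nat.lt_or_ge (y - x).val (z - x).val with h | h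
  · refine Or.inl ⟨hxy, hyz, hxz, fun i => ?_⟩
    have e1 := val_sub_eq_ite (i - x) (y - x)
    have e2 := val_sub_eq_ite (z - x) (y - x)
    rw [sub_sub_sub_cancel_right] at e1 e2
    have := ZMod.val_lt (i - x)
    unfold cycInd
    rw [e1, e2]
    split_ifs <;> omega
  · refine Or.inr ⟨hxz, hyz.symm, hxy, fun i => ?_⟩
    have e1 := val_sub_eq_ite (i - x) (z - x)
    have e2 := val_sub_eq_ite (y - x) (z - x)
    rw [sub_sub_sub_cancel_right] at e1 e2
    have := ZMod.val_lt (i - x)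
    unfold cycInd
    rw [e1, e2]
    split_ifs <;> omega

omit [NeZero n] in
theorem CycOrd.cycInd_outer {x y z : ZMod n} (h : CycOrd x y z) : cycInd x y z = 0 := by
  have h1 := h.split z
  have h2 := cycInd_nonneg x y z
  rw [cycInd_self_right, cycInd_self_right] at h1
  omega

omit [NeZero n] in
theorem CycOrd.cycInd_inner {x y z : ZMod n} (h : CycOrd x y z) : cycInd x z y = 1 := by
  rw [h.split y, cycInd_self_right, cycInd_self_left h.ne₂₃, zero_add]

/-- All values of the indicators of cyclic intervals between three cyclically ordered points,
at these points. -/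
theorem CycOrd.cycInd_values {x y z : ZMod n} (h : CycOrd x y z) :
    (cycInd x y x = 1 ∧ cycInd x y y = 0 ∧ cycInd x y z = 0) ∧
    (cycInd y z x = 0 ∧ cycInd y z y = 1 ∧ cycInd y z z = 0) ∧
    (cycInd z x x = 0 ∧ cycInd z x y = 0 ∧ cycInd z x z = 1) ∧
    (cycInd x z x = 1 ∧ cycInd x z y = 1 ∧ cycInd x z z = 0) ∧
    (cycInd y x x = 0 ∧ cycInd y x y = 1 ∧ cycInd y x z = 1) ∧
    (cycInd z y x = 1 ∧ cycInd z y y = 0 ∧ cycInd z y z = 1) := by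
  have h' := h.rotate
  have h'' := h'.rotate
  simp only [cycInd_self_right, cycInd_self_left h.ne₁₂, cycInd_self_left h.ne₂₃,
    cycInd_self_left h.ne₁₃, cycInd_self_left h'.ne₁₃, cycInd_self_left h''.ne₁₂,
    cycInd_self_left h''.ne₁₃, h.cycInd_inner, h.cycInd_outer, h'.cycInd_inner, h'.cycInd_outer,
    h''.cycInd_inner, h''.cycInd_outer, and_self]

theorem isCyclicInterval_setOf_cycInd {a b : ZMod n} (h : a ≠ b) :
    IsCyclicInterval n {i | cycInd a b i = 1} := by
  have hba := (val_sub_eq_zero_iff b a).not.2 h.symm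
  have hlt := ZMod.val_lt (b - a)
  refine ⟨a, (b - a).val - 1, ?_⟩
  ext i
  simp only [Set.mem_ofPred_eq, cycInd]
  constructor
  · intro hi
    have hi' : (i - a).val < (b - a).val := by
      by_contra hc
      simp [hc] at hi
    refine ⟨(i - a).val, by omega, ?_⟩
    rw [ZMod.natCast_zmod_val]
    ring
  · rintro ⟨m, hm, rfl⟩
    rw [add_sub_cancel_left, ZMod.val_natCast, Nat.mod_eq_of_lt (by omega), if_pos (by omega)]

theorem IsCyclicInterval.exists_cycInd {S : Set (ZMod n)} (h : IsCyclicInterval n S)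
    (hS : S ≠ Set.univ) :
    ∃ a b : ZMod n, a ≠ b ∧ ∀ i, (i ∈ S ↔ cycInd a b i = 1) := by
  obtain ⟨a, k, rfl⟩ := h
  have hk : k + 1 < n := by
    by_contra hc
    apply hS
    ext i
    simp only [Set.mem_ofPred_eq, Set.mem_univ, iff_true]
    refine ⟨(i - a).val, ?_, ?_⟩
    · have := ZMod.val_lt (i - a)
      omega
    · rw [ZMod.natCast_zmod_val]
      ring
  have hv : (a + ((k + 1 : ℕ) : ZMod n) - a).val = k + 1 := by
    rw [add_sub_cancel_left, ZMod.val_natCast, Nat.mod_eq_of_lt hk]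
  refine ⟨a, a + ((k + 1 : ℕ) : ZMod n), ?_, fun i => ?_⟩
  · intro hc
    have := (val_sub_eq_zero_iff _ _).2 hc.symm
    omega
  · simp only [Set.mem_ofPred_eq, cycInd, hv]
    constructor
    · rintro ⟨m, hm, rfl⟩
      rw [add_sub_cancel_left, ZMod.val_natCast, Nat.mod_eq_of_lt (by omega), if_pos (by omega)]
    · intro hi
      have hi' : (i - a).val < k + 1 := by
        by_contra hc
        simp [hc] at hi
      refine ⟨(i - a).val, by omega, ?_⟩
      rw [ZMod.natCast_zmod_val]
      ring

end CyclicIntervals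

section Rectangles

variable {n : ℕ}

/-- The indicator function of the rectangle `[a, b) × [σ a, σ b)`. -/
def rectInd (σ : Equiv.Perm (ZMod n)) (a b i j : ZMod n) : ℤ :=
  cycInd a b i * cycInd (σ a) (σ b) j

theorem rectInd_nonneg (σ : Equiv.Perm (ZMod n)) (a b i j : ZMod n) : 0 ≤ rectInd σ a b i j :=
  mul_nonneg (cycInd_nonneg _ _ _) (cycInd_nonneg _ _ _)

theorem IsGridDomain.sub {σ w τ : Equiv.Perm (ZMod n)} {D E : ZMod n → ZMod n → ℤ}
    (hD : IsGridDomain n σ τ D) (hE : IsGridDomain n σ w E) :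
    IsGridDomain n w τ (fun i j => D i j - E i j) := by
  intro i j
  have h1 := hD i j
  have h2 := hE i j
  simp only
  omega

/-- The target of a domain is determined by the domain and its source. -/
theorem IsGridDomain.target_unique {σ w τ : Equiv.Perm (ZMod n)} {D : ZMod n → ZMod n → ℤ}
    (h₁ : IsGridDomain n σ w D) (h₂ : IsGridDomain n σ τ D) : w = τ := by
  ext i
  have e := h₁ i (w i)
  rw [h₂ i (w i)] at e
  by_contra hc
  simp only [if_true, if_neg hc] at e
  omega

variable [NeZero n]

theorem isGridDomain_rectInd (σ : Equiv.Perm (ZMod n)) {a b : ZMod n} (h : a ≠ b) :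
    IsGridDomain n σ (σ * Equiv.swap a b) (rectInd σ a b) := by
  intro i j
  have e : rectInd σ a b i j - rectInd σ a b (i - 1) j - rectInd σ a b i (j - 1)
      + rectInd σ a b (i - 1) (j - 1) = (cycInd a b i - cycInd a b (i - 1)) *
        (cycInd (σ a) (σ b) j - cycInd (σ a) (σ b) (j - 1)) := by
    unfold rectInd; ring
  rw [e, cycInd_sub_pred, cycInd_sub_pred, Equiv.Perm.mul_apply]
  by_cases hia : i = a
  · subst hia
    simp [h]
  · by_cases hib : i = b
    · subst hib
      simp [hia]
    · simp [hia, hib, Equiv.swap_apply_of_ne_of_ne]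

theorem isRectangle_rectInd (σ : Equiv.Perm (ZMod n)) {a b : ZMod n} (h : a ≠ b) :
    IsRectangle n σ (σ * Equiv.swap a b) (rectInd σ a b) := by
  refine ⟨isGridDomain_rectInd σ h, _, _, isCyclicInterval_setOf_cycInd h,
    isCyclicInterval_setOf_cycInd (σ.injective.ne h), ?_, ?_, fun i j => ?_⟩
  · intro hc
    have : b ∈ {i | cycInd a b i = 1} := hc ▸ Set.mem_univ b
    simp [cycInd_self_right] at this
  · intro hc
    have : σ b ∈ {i | cycInd (σ a) (σ b) i = 1} := hc ▸ Set.mem_univ (σ b)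
    simp [cycInd_self_right] at this
  · unfold rectInd
    rcases cycInd_eq_zero_or_one a b i with h1 | h1 <;>
      rcases cycInd_eq_zero_or_one (σ a) (σ b) j with h2 | h2 <;>
      simp [h1, h2]

theorem IsRectangle.exists_rectInd {σ w : Equiv.Perm (ZMod n)} {R : ZMod n → ZMod n → ℤ}
    (h : IsRectangle n σ w R) :
    ∃ a b, a ≠ b ∧ w = σ * Equiv.swap a b ∧ R = rectInd σ a b := by
  obtain ⟨hR, I, J, hI, hJ, hI', hJ', hIJ⟩ := h
  obtain ⟨a, b, hab, ha⟩ := hI.exists_cycInd hI'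
  obtain ⟨c, d, hcd, hc⟩ := hJ.exists_cycInd hJ'
  have hRe : ∀ i j, R i j = cycInd a b i * cycInd c d j := by
    intro i j
    rw [hIJ]
    rcases cycInd_eq_zero_or_one a b i with h1 | h1 <;>
      rcases cycInd_eq_zero_or_one c d j with h2 | h2 <;>
      simp [ha, hc, h1, h2]
  have key : ∀ i j, ((if i = a then 1 else 0) - (if i = b then 1 else 0)) *
      ((if j = c then 1 else 0) - (if j = d then 1 else 0)) =
      (if j = σ i then 1 else 0) - (if j = w i then (1 : ℤ) else 0) := by
    intro i j
    rw [← cycInd_sub_pred, ← cycInd_sub_pred, ← hR i j, hRe, hRe, hRe, hRe]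
    ring
  have hac := key a c
  have hbd := key b d
  simp only [hab, hab.symm, hcd, hcd.symm, if_true, if_false] at hac hbd
  have hσa : c = σ a := by
    by_contra h0
    rw [if_neg h0] at hac
    split_ifs at hac <;> omega
  have hσb : d = σ b := by
    by_contra h0
    rw [if_neg h0] at hbd
    split_ifs at hbd <;> omega
  subst hσa hσb
  have hRr : R = rectInd σ a b := by
    funext i j
    rw [hRe]
    rfl
  exact ⟨a, b, hab, hR.target_unique (hRr ▸ isGridDomain_rectInd σ hab), hRr⟩

/-- The corners of a rectangle are determined by its indicator function. -/
theorem rectInd_inj {σ : Equiv.Perm (ZMod n)} {a b c d : ZMod n} (hab : a ≠ b)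
    (h : rectInd σ a b = rectInd σ c d) : a = c ∧ b = d := by
  have key : ∀ i, ((if i = a then 1 else 0) - (if i = b then (1 : ℤ) else 0)) =
      ((if i = c then 1 else 0) - (if i = d then 1 else 0)) * cycInd (σ c) (σ d) (σ a) := by
    intro i
    have h1 := congrFun (congrFun h i) (σ a)
    have h2 := congrFun (congrFun h (i - 1)) (σ a)
    simp only [rectInd, cycInd_self_left (σ.injective.ne hab), mul_one] at h1 h2
    rw [← cycInd_sub_pred, ← cycInd_sub_pred, h1, h2]
    ring
  have ha := key a
  have hb := key b
  simp only [hab, hab.symm, if_true, if_false] at ha hb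
  rcases cycInd_eq_zero_or_one (σ c) (σ d) (σ a) with h0 | h0 <;> rw [h0] at ha hb
  · simp at ha
  · constructor
    · by_contra hc
      rw [if_neg hc] at ha
      split_ifs at ha <;> omega
    · by_contra hc
      rw [if_neg hc] at hb
      split_ifs at hb <;> omega

end Rectangles

section Maslov

variable {n : ℕ} [NeZero n]

theorem sum_comp_sub_one {M : Type*} [AddCommMonoid M] (f : ZMod n → M) :
    ∑ i, f (i - 1) = ∑ i, f i :=
  (Equiv.subRight (1 : ZMod n)).sum_comp f

/-- Summation by parts on `ℤ/n`. -/
theorem sum_sub_mul_add (f g : ZMod n → ℚ) :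
    ∑ i, (f i - f (i - 1)) * (g i + g (i - 1)) = -∑ i, (f i + f (i - 1)) * (g i - g (i - 1)) := by
  rw [eq_neg_iff_add_eq_zero, ← Finset.sum_add_distrib]
  have := sum_comp_sub_one (fun i => 2 * (f i * g i))
  rw [← sub_eq_zero.2 this.symm, ← Finset.sum_sub_distrib]
  refine Finset.sum_congr rfl fun i _ => ?_
  ring

/-- The pairing between the mixed difference of one function on the torus and the point measure
of another one is symmetric. -/
theorem sum_mixedDiff_mul_ptMeasure (D E : ZMod n → ZMod n → ℤ) :
    ∑ i, ∑ j, ((D i j - D (i - 1) j - D i (j - 1) + D (i - 1) (j - 1) : ℤ) : ℚ) *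
      ptMeasure n E i j =
    ∑ i, ∑ j, ((E i j - E (i - 1) j - E i (j - 1) + E (i - 1) (j - 1) : ℤ) : ℚ) *
      ptMeasure n D i j := by
  have h1 : ∀ j, _ := fun j => sum_sub_mul_add (fun i => (D i j - D i (j - 1) : ℚ))
    (fun i => (E i j + E i (j - 1) : ℚ) / 4)
  have h2 : ∀ i, _ := fun i => sum_sub_mul_add (fun j => (D i j + D (i - 1) j : ℚ))
    (fun j => (E i j - E (i - 1) j : ℚ) / 4)
  have e1 := Finset.sum_congr rfl fun j (_ : j ∈ Finset.univ) => h1 j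
  have e2 := Finset.sum_congr rfl fun i (_ : i ∈ Finset.univ) => h2 i
  rw [Finset.sum_comm, Finset.sum_neg_distrib] at e1
  rw [Finset.sum_neg_distrib] at e2
  have e3 : ∀ {f g : ZMod n → ZMod n → ℚ}, (∀ i j, f i j = g i j) →
      ∑ i, ∑ j, f i j = ∑ i, ∑ j, g i j := fun h =>
    Finset.sum_congr rfl fun i _ => Finset.sum_congr rfl fun j _ => h i j
  refine Eq.trans ?_ (e1.trans (Eq.trans ?_ ((neg_eq_iff_eq_neg.2 e2).trans ?_)))
  · refine e3 fun i j => ?_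
    simp only [ptMeasure]; push_cast; ring
  · rw [Finset.sum_comm]
    refine congrArg _ (e3 fun i j => ?_)
    ring
  · refine e3 fun i j => ?_
    simp only [ptMeasure]; push_cast; ring

theorem IsGridDomain.sum_mul {σ τ : Equiv.Perm (ZMod n)} {D : ZMod n → ZMod n → ℤ}
    (hD : IsGridDomain n σ τ D) (f : ZMod n → ZMod n → ℚ) :
    ∑ i, ∑ j, ((D i j - D (i - 1) j - D i (j - 1) + D (i - 1) (j - 1) : ℤ) : ℚ) * f i j =
      ∑ i, f i (σ i) - ∑ i, f i (τ i) := by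
  rw [← Finset.sum_sub_distrib]
  refine Finset.sum_congr rfl fun i _ => ?_
  simp_rw [hD i]
  push_cast
  simp [sub_mul, Finset.sum_sub_distrib]

theorem maslov_add {σ w τ : Equiv.Perm (ZMod n)} {D E : ZMod n → ZMod n → ℤ}
    (hD : IsGridDomain n σ w D) (hE : IsGridDomain n w τ E) :
    maslov n σ τ (fun i j => D i j + E i j) = maslov n σ w D + maslov n w τ E := by
  have h := sum_mixedDiff_mul_ptMeasure D E
  rw [hD.sum_mul, hE.sum_mul] at h
  have hp : ∀ i j, ptMeasure n (fun i j => D i j + E i j) i j =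
      ptMeasure n D i j + ptMeasure n E i j := by
    intro i j
    simp only [ptMeasure]; push_cast; ring
  simp only [maslov, hp, Finset.sum_add_distrib]
  linarith

omit [NeZero n] in
theorem ptMeasure_nonneg {D : ZMod n → ZMod n → ℤ} (h : ∀ i j, 0 ≤ D i j) (i j : ZMod n) :
    0 ≤ ptMeasure n D i j := by
  unfold ptMeasure
  have h1 := h i j
  have h2 := h (i - 1) j
  have h3 := h i (j - 1)
  have h4 := h (i - 1) (j - 1)
  positivity

omit [NeZero n] in
theorem ptMeasure_rectInd (σ : Equiv.Perm (ZMod n)) (a b i j : ZMod n) :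
    ptMeasure n (rectInd σ a b) i j = ((cycInd a b i + cycInd a b (i - 1) : ℤ) : ℚ) *
      ((cycInd (σ a) (σ b) j + cycInd (σ a) (σ b) (j - 1) : ℤ) : ℚ) / 4 := by
  simp only [ptMeasure, rectInd]; push_cast; ring

theorem cycInd_add_pred_left {a b : ZMod n} (h : a ≠ b) :
    cycInd a b a + cycInd a b (a - 1) = 1 := by
  have := cycInd_sub_pred a b a
  rw [if_pos rfl, if_neg h, cycInd_self_left h] at this
  rw [cycInd_self_left h]
  omega

theorem cycInd_add_pred_right {a b : ZMod n} (h : a ≠ b) :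
    cycInd a b b + cycInd a b (b - 1) = 1 := by
  have := cycInd_sub_pred a b b
  rw [if_pos rfl, if_neg h.symm, cycInd_self_right] at this
  rw [cycInd_self_right]
  omega

/-- No point of `σ` lies in the interior of the rectangle `[a, b) × [σ a, σ b)`. -/
def RectEmpty (σ : Equiv.Perm (ZMod n)) (a b : ZMod n) : Prop :=
  ∀ i, i ≠ a → rectInd σ a b i (σ i) = 0

theorem maslov_rectInd {σ : Equiv.Perm (ZMod n)} {a b : ZMod n} (h : a ≠ b)
    (he : RectEmpty σ a b) : maslov n σ (σ * Equiv.swap a b) (rectInd σ a b) = 1 := by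
  have hσ := σ.injective.ne h
  have h0 : ∀ i, i ≠ a ∧ i ≠ b → ptMeasure n (rectInd σ a b) i (σ i) = 0 := by
    rintro i ⟨hia, hib⟩
    have := he i hia
    unfold rectInd at this
    rw [ptMeasure_rectInd, cycInd_pred_of_ne hia hib,
      cycInd_pred_of_ne (σ.injective.ne hia) (σ.injective.ne hib)]
    have h' : ((cycInd a b i : ℤ) : ℚ) * (cycInd (σ a) (σ b) (σ i) : ℤ) = 0 := by
      exact_mod_cast this
    push_cast
    linear_combination h'
  have h1 : ∑ i, ptMeasure n (rectInd σ a b) i (σ i) = 1 / 2 := by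
    rw [Finset.sum_eq_add a b h (fun i _ hi => h0 i hi) (by simp) (by simp),
      ptMeasure_rectInd, ptMeasure_rectInd, cycInd_add_pred_left h, cycInd_add_pred_right h,
      cycInd_add_pred_left hσ, cycInd_add_pred_right hσ]
    norm_num
  have h2 : ∑ i, ptMeasure n (rectInd σ a b) i ((σ * Equiv.swap a b) i) = 1 / 2 := by
    rw [Finset.sum_eq_add a b h (fun i _ hi => ?_) (by simp) (by simp),
      ptMeasure_rectInd, ptMeasure_rectInd, cycInd_add_pred_left h, cycInd_add_pred_right h,
      Equiv.Perm.mul_apply, Equiv.Perm.mul_apply, Equiv.swap_apply_left, Equiv.swap_apply_right,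
      cycInd_add_pred_left hσ, cycInd_add_pred_right hσ]
    · norm_num
    · rw [Equiv.Perm.mul_apply, Equiv.swap_apply_of_ne_of_ne hi.1 hi.2]
      exact h0 i hi
  rw [maslov, h1, h2]
  norm_num

/-- The horizontal differences of a domain from a grid state to itself are constant on columns. -/
theorem IsGridDomain.sub_pred_eq {σ : Equiv.Perm (ZMod n)} {D : ZMod n → ZMod n → ℤ}
    (hD : IsGridDomain n σ σ D) (i j k : ZMod n) :
    D i j - D (i - 1) j = D i k - D (i - 1) k := by
  have hstep : ∀ t : ℕ, D i (k + t) - D (i - 1) (k + t) = D i k - D (i - 1) k := by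
    intro t
    induction t with
    | zero => simp
    | succ t ih =>
      have h := hD i (k + (t + 1 : ℕ))
      rw [show k + ((t + 1 : ℕ) : ZMod n) - 1 = k + t by push_cast; ring, sub_self] at h
      omega
  have h := hstep (j - k).val
  rwa [ZMod.natCast_zmod_val, add_sub_cancel] at h

/-- A positive domain of Maslov index zero is trivial. -/
theorem IsGridDomain.eq_zero_of_maslov_eq_zero {σ τ : Equiv.Perm (ZMod n)}
    {D : ZMod n → ZMod n → ℤ} (hD : IsGridDomain n σ τ D) (hpos : ∀ i j, 0 ≤ D i j)
    (hμ : maslov n σ τ D = 0) : σ = τ ∧ ∀ i j, D i j = 0 := by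
  have hp := ptMeasure_nonneg hpos
  have hs : ∑ i, ptMeasure n D i (σ i) = 0 := by
    have h1 := Finset.sum_nonneg fun i (_ : i ∈ Finset.univ) => hp i (σ i)
    have h2 := Finset.sum_nonneg fun i (_ : i ∈ Finset.univ) => hp i (τ i)
    unfold maslov at hμ
    linarith
  rw [Finset.sum_eq_zero_iff_of_nonneg fun i _ => hp i (σ i)] at hs
  have h4 : ∀ i, D i (σ i) = 0 ∧ D (i - 1) (σ i) = 0 ∧ D i (σ i - 1) = 0 ∧
      D (i - 1) (σ i - 1) = 0 := by
    intro i
    have h := hs i (Finset.mem_univ i)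
    unfold ptMeasure at h
    rw [div_eq_zero_iff] at h
    have h' : D i (σ i) + D (i - 1) (σ i) + D i (σ i - 1) + D (i - 1) (σ i - 1) = 0 := by
      rcases h with h | h
      · exact_mod_cast h
      · norm_num at h
    have := hpos i (σ i)
    have := hpos (i - 1) (σ i)
    have := hpos i (σ i - 1)
    have := hpos (i - 1) (σ i - 1)
    omega
  have hστ : σ = τ := by
    ext i
    have h := hD i (σ i)
    obtain ⟨h1, h2, h3, h4⟩ := h4 i
    by_contra hc
    simp [h1, h2, h3, h4, hc] at h
  subst hστ
  refine ⟨rfl, ?_⟩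
  have hrow : ∀ i j, D i j = D (i - 1) j := by
    intro i j
    have h := hD.sub_pred_eq i j (σ i)
    rw [(h4 i).1, (h4 i).2.1] at h
    omega
  have hcol : ∀ (i j : ZMod n) (t : ℕ), D (i + t) j = D i j := by
    intro i j t
    induction t with
    | zero => simp
    | succ t ih =>
      rw [hrow, ← ih]
      congr 1
      push_cast; ring
  intro i j
  have h := hcol (σ.symm j) j (i - σ.symm j).val
  rw [ZMod.natCast_zmod_val, add_sub_cancel] at h
  have h' := (h4 (σ.symm j)).1
  rw [Equiv.apply_symm_apply] at h'
  rw [h, h']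

/-- A domain from a grid state to itself has even Maslov index. -/
theorem IsGridDomain.exists_maslov_eq_two_mul {σ : Equiv.Perm (ZMod n)}
    {D : ZMod n → ZMod n → ℤ} (hD : IsGridDomain n σ σ D) :
    ∃ m : ℤ, maslov n σ σ D = 2 * m := by
  have hstep : ∀ (i j : ZMod n) (t : ℕ),
      D i (j + t) - D (i - 1) (j + t) = D i j - D (i - 1) j := by
    intro i j t
    induction t with
    | zero => simp
    | succ t ih =>
      have h := hD i (j + (t + 1 : ℕ))
      rw [show j + ((t + 1 : ℕ) : ZMod n) - 1 = j + t by push_cast; ring, sub_self] at h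
      omega
  have hcol : ∀ (j : ZMod n) (t : ℕ), D t j = D t 0 + D 0 j - D 0 0 := by
    intro j t
    induction t with
    | zero => simp
    | succ t ih =>
      have h := hD.sub_pred_eq ((t + 1 : ℕ) : ZMod n) j 0
      rw [show ((t + 1 : ℕ) : ZMod n) - 1 = t by push_cast; ring] at h
      omega
  have hsplit : ∀ i j, D i j = D i 0 + (D 0 j - D 0 0) := by
    intro i j
    have h := hcol j i.val
    rw [ZMod.natCast_zmod_val] at h
    omega
  refine ⟨∑ i, D i 0 + ∑ j, (D 0 j - D 0 0), ?_⟩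
  have hsum : ∑ i, ptMeasure n D i (σ i) =
      ((∑ i, D i 0 + ∑ j, (D 0 j - D 0 0) : ℤ) : ℚ) := by
    have e : ∀ i, ptMeasure n D i (σ i) = (D i 0 : ℚ) / 2 + (D (i - 1) 0 : ℚ) / 2 +
        ((D 0 (σ i) - D 0 0 : ℚ) / 2 + (D 0 (σ i - 1) - D 0 0 : ℚ) / 2) := by
      intro i
      unfold ptMeasure
      rw [hsplit i (σ i), hsplit (i - 1) (σ i), hsplit i (σ i - 1), hsplit (i - 1) (σ i - 1)]
      push_cast; ring
    have s1 := sum_comp_sub_one fun i => (D i 0 : ℚ) / 2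
    have s2 := sum_comp_sub_one fun j => (D 0 j - D 0 0 : ℚ) / 2
    have s3 := Equiv.sum_comp σ fun j => (D 0 j - D 0 0 : ℚ) / 2
    have s4 := Equiv.sum_comp σ fun j => (D 0 (j - 1) - D 0 0 : ℚ) / 2
    simp only [e, Finset.sum_add_distrib]
    rw [s1, s3, s4, s2, ← Finset.sum_div, ← Finset.sum_div]
    push_cast; ring
  unfold maslov
  rw [hsum]; ring

end Maslov

section Existence

variable {n : ℕ} [NeZero n]

omit [NeZero n] in
/-- Away from `σ i`, the horizontal difference of a domain decreases along the column `i`. -/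
theorem IsGridDomain.sub_pred_add_le {σ τ : Equiv.Perm (ZMod n)} {D : ZMod n → ZMod n → ℤ}
    (hD : IsGridDomain n σ τ D) (i c : ZMod n) (s : ℕ)
    (hs : ∀ t : ℕ, 1 ≤ t → t ≤ s → σ i ≠ c + t) :
    D i (c + s) - D (i - 1) (c + s) ≤ D i c - D (i - 1) c := by
  induction s with
  | zero => simp
  | succ s ih =>
    have h := hD i (c + (s + 1 : ℕ))
    have ih' := ih fun t h1 h2 => hs t h1 (by omega)
    rw [if_neg (hs (s + 1) (by omega) le_rfl).symm,
      show c + ((s + 1 : ℕ) : ZMod n) - 1 = c + s by push_cast; ring] at h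
    split_ifs at h <;> omega

omit [NeZero n] in
theorem add_natCast_inj (c : ZMod n) {s t : ℕ} (hs : s < n) (ht : t < n)
    (h : c + (s : ZMod n) = c + t) : s = t := by
  have h' := congrArg ZMod.val (add_left_cancel h)
  rwa [ZMod.val_natCast, ZMod.val_natCast, Nat.mod_eq_of_lt hs, Nat.mod_eq_of_lt ht] at h'

omit [NeZero n] in
/-- The horizontal difference along the column `i`, read upwards from the point of `σ`,
is decreasing. -/
theorem IsGridDomain.sub_pred_antitone {σ τ : Equiv.Perm (ZMod n)} {D : ZMod n → ZMod n → ℤ}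
    (hD : IsGridDomain n σ τ D) (i : ZMod n) {s t : ℕ} (hts : t ≤ s) (hs : s < n) :
    D i (σ i + s) - D (i - 1) (σ i + s) ≤ D i (σ i + t) - D (i - 1) (σ i + t) := by
  have h := hD.sub_pred_add_le i (σ i + t) (s - t) (fun u h1 h2 hc => ?_)
  · rwa [add_assoc, ← Nat.cast_add, Nat.add_sub_cancel' hts] at h
  · have := add_natCast_inj (σ i) (s := 0) (t := t + u) (by omega) (by omega)
      (by rw [Nat.cast_zero, add_zero, Nat.cast_add, ← add_assoc]; exact hc)
    omega

/-- A nontrivial domain has a column along which the horizontal difference is somewhere positive. -/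
theorem IsGridDomain.exists_one_le_sub_pred {σ τ : Equiv.Perm (ZMod n)}
    {D : ZMod n → ZMod n → ℤ} (hD : IsGridDomain n σ τ D) (hστ : σ ≠ τ) :
    ∃ i j, 1 ≤ D i j - D (i - 1) j := by
  by_contra! hc
  apply hστ
  have h0 : ∀ i j, D i j - D (i - 1) j = 0 := by
    intro i j
    have hsum : ∑ i, (D i j - D (i - 1) j) = 0 := by
      rw [Finset.sum_sub_distrib, sum_comp_sub_one fun i => D i j, sub_self]
    have := (Finset.sum_eq_zero_iff_of_nonpos
      (fun i _ => by have := hc i j; omega)).1 hsum i (Finset.mem_univ i)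
    exact this
  ext i
  have h := hD i (σ i)
  have h1 := h0 i (σ i)
  have h2 := h0 i (σ i - 1)
  by_contra hne
  rw [if_pos rfl, if_neg hne] at h
  omega

omit [NeZero n] in
theorem cycInd_eq_one_iff {a b i : ZMod n} : cycInd a b i = 1 ↔ (i - a).val < (b - a).val := by
  unfold cycInd
  split_ifs with h <;> simp [h]

theorem rectInd_le {σ : Equiv.Perm (ZMod n)} {D : ZMod n → ZMod n → ℤ}
    (hpos : ∀ i j, 0 ≤ D i j) {a b : ZMod n}
    (h : ∀ s t : ℕ, s < (b - a).val → t < (σ b - σ a).val → 1 ≤ D (a + s) (σ a + t)) :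
    ∀ i j, rectInd σ a b i j ≤ D i j := by
  intro i j
  unfold rectInd
  rcases cycInd_eq_zero_or_one a b i with h1 | h1
  · simp [h1, hpos]
  rcases cycInd_eq_zero_or_one (σ a) (σ b) j with h2 | h2
  · simp [h2, hpos]
  have := h _ _ (cycInd_eq_one_iff.1 h1) (cycInd_eq_one_iff.1 h2)
  rw [ZMod.natCast_zmod_val, ZMod.natCast_zmod_val, add_sub_cancel, add_sub_cancel] at this
  rw [h1, h2]
  omega

/-- A positive nontrivial domain contains a rectangle that starts at its source. -/
theorem IsGridDomain.exists_rectInd_le {σ τ : Equiv.Perm (ZMod n)} {D : ZMod n → ZMod n → ℤ}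
    (hD : IsGridDomain n σ τ D) (hn : 2 ≤ n) (hpos : ∀ i j, 0 ≤ D i j) (hστ : σ ≠ τ) :
    ∃ a b, a ≠ b ∧ ∀ i j, rectInd σ a b i j ≤ D i j := by
  let P : ℕ → Prop := fun l => ∃ a, ∀ t : ℕ, t < l → 1 ≤ D a (σ a + t)
  have hP1 : P 1 := by
    obtain ⟨i, j, hij⟩ := hD.exists_one_le_sub_pred hστ
    have h := hD.sub_pred_antitone i (s := (j - σ i).val) (Nat.zero_le _) (ZMod.val_lt _)
    rw [ZMod.natCast_zmod_val, add_sub_cancel] at h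
    refine ⟨i, fun t ht => ?_⟩
    obtain rfl : t = 0 := by omega
    have := hpos (i - 1) (σ i + (0 : ℕ))
    omega
  by_cases hPn : P n
  · obtain ⟨a, ha⟩ := hPn
    have : Fact (1 < n) := ⟨hn⟩
    refine ⟨a, a + 1, by simp, rectInd_le hpos fun s t hs ht => ?_⟩
    rw [add_sub_cancel_left, ZMod.val_one] at hs
    obtain rfl : s = 0 := by omega
    rw [Nat.cast_zero, add_zero]
    exact ha t (ht.trans (ZMod.val_lt _))
  obtain ⟨l, hl1, hln, ⟨a, ha⟩, hmax⟩ : ∃ l, 1 ≤ l ∧ l < n ∧ P l ∧ ¬ P (l + 1) := by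
    by_contra! hc
    have : ∀ l, 1 ≤ l → l ≤ n → P l := by
      intro l hl
      induction l, hl using Nat.le_induction with
      | base => exact fun _ => hP1
      | succ l hl ih => exact fun h => hc l hl (by omega) (ih (by omega))
    exact hPn (this n (by omega) le_rfl)
  have had : D a (σ a + l) = 0 := by
    by_contra h0
    refine hmax ⟨a, fun t ht => ?_⟩
    rcases Nat.lt_succ_iff_lt_or_eq.1 ht with h | rfl
    · exact ha t h
    · have := hpos a (σ a + t)
      omega
  by_contra! hno
  have hN : ∀ k : ℕ, 1 ≤ k → k < n →
      (∀ s : ℕ, s < k → ∀ t : ℕ, t < l → 1 ≤ D (a + s) (σ a + t)) →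
      ∀ t : ℕ, 1 ≤ t → t ≤ l → σ (a + k) ≠ σ a + t := by
    intro k hk hkn hQ t ht htl hσ
    have hv : (a + (k : ZMod n) - a).val = k := by
      rw [add_sub_cancel_left, ZMod.val_natCast, Nat.mod_eq_of_lt hkn]
    obtain ⟨i, j, hij⟩ := hno a (a + k) (fun h => by
      have := (val_sub_eq_zero_iff _ _).2 h.symm
      omega)
    refine hij.not_ge (rectInd_le hpos (fun s u hs hu => ?_) i j)
    rw [hσ, add_sub_cancel_left, ZMod.val_natCast, Nat.mod_eq_of_lt (by omega)] at hu
    exact hQ s (by omega) u (by omega)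
  have hS : ∀ k : ℕ, k < n → ∀ s : ℕ, s ≤ k →
      (∀ t : ℕ, t < l → 1 ≤ D (a + s) (σ a + t)) ∧ D (a + s) (σ a + l) = 0 := by
    intro k
    induction k with
    | zero =>
      intro _ s hs
      obtain rfl : s = 0 := by omega
      rw [Nat.cast_zero, add_zero]
      exact ⟨ha, had⟩
    | succ k ih =>
      intro hkn s hs
      have ih' := ih (by omega)
      rcases Nat.le_or_eq_of_le_succ hs with h | rfl
      · exact ih' s h
      have hN' := hN (k + 1) (by omega) hkn (fun s hs => (ih' s (by omega)).1)
      obtain ⟨hk1, hk2⟩ := ih' k le_rfl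
      set i : ZMod n := a + (k + 1 : ℕ) with hi
      have hpred : i - 1 = a + k := by
        rw [hi]; push_cast; ring
      have hd0 : D i (σ a + l) = 0 := by
        by_contra h0
        have hge : 1 ≤ D i (σ a + l) - D (i - 1) (σ a + l) := by
          have := hpos i (σ a + l)
          rw [hpred]
          omega
        have he : σ i + ((σ a + l - σ i).val : ZMod n) = σ a + l := by
          rw [ZMod.natCast_zmod_val, add_sub_cancel]
        have hlt := ZMod.val_lt (n := n) (σ a + l - σ i)
        refine hmax ⟨i, fun t ht => ?_⟩
        have hle : l ≤ (σ a + l - σ i).val := by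
          by_contra hlt'
          refine hN' (l - (σ a + l - σ i).val) (by omega) (by omega) ?_
          rw [Nat.cast_sub (by omega), ZMod.natCast_zmod_val]
          ring
        have hanti := hD.sub_pred_antitone i (t := t) (s := (σ a + l - σ i).val)
          (by omega) hlt
        rw [he] at hanti
        have := hpos (i - 1) (σ i + t)
        omega
      refine ⟨fun t ht => ?_, hd0⟩
      have hle := hD.sub_pred_add_le i (σ a + t) (l - t) (fun u h1 h2 hc =>
        hN' (t + u) (by omega) (by omega) (by rw [hc]; push_cast; ring))
      rw [add_assoc, ← Nat.cast_add, Nat.add_sub_cancel' ht.le, hpred, hd0, hk2] at hle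
      have := hk1 t ht
      omega
  have hσ : a + ((σ.symm (σ a + l) - a).val : ZMod n) = σ.symm (σ a + l) := by
    rw [ZMod.natCast_zmod_val, add_sub_cancel]
  refine hN (σ.symm (σ a + l) - a).val ?_ (ZMod.val_lt _)
    (fun s hs => (hS s (hs.trans (ZMod.val_lt _)) s le_rfl).1) l hl1 le_rfl
    (by rw [hσ, Equiv.apply_symm_apply])
  rw [Nat.one_le_iff_ne_zero, Ne, val_sub_eq_zero_iff, Equiv.symm_apply_eq]
  intro hc
  have := add_natCast_inj (σ a) (s := l) (t := 0) hln (by omega) (by simpa using hc)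
  omega

/-- A positive nontrivial domain contains an empty rectangle that starts at its source. -/
theorem IsGridDomain.exists_rectEmpty_le {σ τ : Equiv.Perm (ZMod n)} {D : ZMod n → ZMod n → ℤ}
    (hD : IsGridDomain n σ τ D) (hn : 2 ≤ n) (hpos : ∀ i j, 0 ≤ D i j) (hστ : σ ≠ τ) :
    ∃ a b, a ≠ b ∧ RectEmpty σ a b ∧ ∀ i j, rectInd σ a b i j ≤ D i j := by
  obtain ⟨a, b, hab, hle⟩ := hD.exists_rectInd_le hn hpos hστ
  induction hm : (b - a).val using Nat.strong_induction_on generalizing b with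
  | _ m ih =>
    by_cases he : RectEmpty σ a b
    · exact ⟨a, b, hab, he, hle⟩
    unfold RectEmpty at he
    push Not at he
    obtain ⟨e, hea, hne⟩ := he
    unfold rectInd at hne
    have h1 := cycInd_eq_one_iff.1 ((cycInd_eq_zero_or_one a b e).resolve_left
      (left_ne_zero_of_mul hne))
    have h2 := cycInd_eq_one_iff.1 ((cycInd_eq_zero_or_one (σ a) (σ b) (σ e)).resolve_left
      (right_ne_zero_of_mul hne))
    refine ih (e - a).val (by omega) e hea.symm (fun i j => ?_) rfl
    have h3 := hle i j
    unfold rectInd cycInd at *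
    refine le_trans ?_ h3
    split_ifs <;> omega

end Existence

section Decompositions

variable {n : ℕ} [NeZero n]

/-- `D` is the concatenation of the rectangle starting at `σ` with corner columns `a`, `b` and the
rectangle ending at `τ` with corner columns `a'`, `b'`. -/
structure Decomp (σ τ : Equiv.Perm (ZMod n)) (D : ZMod n → ZMod n → ℤ) (a b a' b' : ZMod n) :
    Prop where
  ne₁ : a ≠ b
  ne₂ : a' ≠ b'
  target : τ = σ * Equiv.swap a b * Equiv.swap a' b'
  eq_add : ∀ i j, D i j = rectInd σ a b i j + rectInd (σ * Equiv.swap a b) a' b' i j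

/-- There are exactly two decompositions of `D`, distinguished by the columns of their first
rectangles. -/
def HasTwoDecomps (σ τ : Equiv.Perm (ZMod n)) (D : ZMod n → ZMod n → ℤ) : Prop :=
  ∃ a b a' b' c d c' d', Decomp σ τ D a b a' b' ∧ Decomp σ τ D c d c' d' ∧ ¬ (a = c ∧ b = d) ∧
    ∀ e f e' f', Decomp σ τ D e f e' f' → (e = a ∧ f = b) ∨ (e = c ∧ f = d)

/-- A positive domain of Maslov index two is a concatenation of two empty rectangles. -/
theorem IsGridDomain.exists_decomp {σ τ : Equiv.Perm (ZMod n)} {D : ZMod n → ZMod n → ℤ}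
    (hD : IsGridDomain n σ τ D) (hn : 2 ≤ n) (hpos : ∀ i j, 0 ≤ D i j) (hστ : σ ≠ τ)
    (hμ : maslov n σ τ D = 2) :
    ∃ a b a' b', Decomp σ τ D a b a' b' ∧ RectEmpty σ a b ∧
      RectEmpty (σ * Equiv.swap a b) a' b' := by
  have step : ∀ {σ : Equiv.Perm (ZMod n)} {D : ZMod n → ZMod n → ℤ} {a b : ZMod n},
      IsGridDomain n σ τ D → a ≠ b → RectEmpty σ a b →
      maslov n (σ * Equiv.swap a b) τ (fun i j => D i j - rectInd σ a b i j) =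
        maslov n σ τ D - 1 := by
    intro σ D a b hD hab he
    have h := maslov_add (isGridDomain_rectInd σ hab) (hD.sub (isGridDomain_rectInd σ hab))
    simp only [add_sub_cancel] at h
    rw [maslov_rectInd hab he] at h
    linarith
  obtain ⟨a, b, hab, he, hle⟩ := hD.exists_rectEmpty_le hn hpos hστ
  have hD₁ := hD.sub (isGridDomain_rectInd σ hab)
  have hμ₁ := step hD hab he
  rw [hμ] at hμ₁
  have hne : σ * Equiv.swap a b ≠ τ := by
    rintro rfl
    obtain ⟨m, hm⟩ := hD₁.exists_maslov_eq_two_mul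
    rw [hμ₁] at hm
    have : (2 : ℤ) * m = 1 := by
      have h' : (2 : ℚ) * m = 1 := by linarith
      exact_mod_cast h'
    omega
  obtain ⟨a', b', hab', he', hle'⟩ :=
    hD₁.exists_rectEmpty_le hn (fun i j => sub_nonneg.2 (hle i j)) hne
  have hμ₂ := step hD₁ hab' he'
  rw [hμ₁] at hμ₂
  obtain ⟨hτ, h0⟩ := (hD₁.sub (isGridDomain_rectInd _ hab')).eq_zero_of_maslov_eq_zero
    (fun i j => sub_nonneg.2 (hle' i j)) (by rw [hμ₂]; norm_num)
  refine ⟨a, b, a', b', ⟨hab, hab', hτ.symm, fun i j => ?_⟩, he, he'⟩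
  have := h0 i j
  omega

omit [NeZero n] in
theorem Decomp.rectInd_le {σ τ : Equiv.Perm (ZMod n)} {D : ZMod n → ZMod n → ℤ}
    {a b a' b' : ZMod n} (h : Decomp σ τ D a b a' b') (i j : ZMod n) :
    rectInd σ a b i j ≤ D i j := by
  have h1 := h.eq_add i j
  have h2 := rectInd_nonneg (σ * Equiv.swap a b) a' b' i j
  omega

omit [NeZero n] in
/-- The corner columns of the first rectangle of a decomposition are moved. -/
theorem Decomp.moved {σ τ : Equiv.Perm (ZMod n)} {D : ZMod n → ZMod n → ℤ}
    {a b a' b' : ZMod n} (h : Decomp σ τ D a b a' b') (hστ : σ ≠ τ) : τ a ≠ σ a ∧ τ b ≠ σ b := by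
  have hne : Equiv.swap a' b' ≠ Equiv.swap a b := by
    intro hs
    apply hστ
    rw [h.target, hs, mul_assoc, Equiv.swap_mul_self, mul_one]
  have hs : ∀ {p q : ZMod n}, p ≠ q → Equiv.swap a' b' p = q →
      Equiv.swap a' b' = Equiv.swap p q := by
    intro p q hpq h'
    rw [Equiv.swap_apply_def] at h'
    split_ifs at h' with h1 h2
    · rw [h1, h']
    · rw [h2, h', Equiv.swap_comm]
    · exact absurd h' hpq
  have e : ∀ i, τ i = σ i → Equiv.swap a' b' i = Equiv.swap a b i := by
    intro i hi
    rw [h.target, Equiv.Perm.mul_apply, Equiv.Perm.mul_apply, σ.injective.eq_iff] at hi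
    rw [← hi, Equiv.swap_apply_self, hi]
  constructor
  · intro hi
    have := e a hi
    rw [Equiv.swap_apply_left] at this
    exact hne (hs h.ne₁ this)
  · intro hi
    have := e b hi
    rw [Equiv.swap_apply_right] at this
    exact hne ((hs h.ne₁.symm this).trans (Equiv.swap_comm _ _))

/-- The first rectangle of a decomposition whose rectangles have disjoint corner columns cannot be
replaced by the complementary one. -/
theorem Decomp.not_reverse {σ τ : Equiv.Perm (ZMod n)} {D : ZMod n → ZMod n → ℤ}
    {a b a' b' e f : ZMod n} (h : Decomp σ τ D a b a' b') (h₁ : a ≠ a') (h₂ : a ≠ b') :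
    ¬ Decomp σ τ D b a e f := by
  intro h'
  have hs : Equiv.swap e f = Equiv.swap a' b' := by
    have := h.target.symm.trans h'.target
    rw [Equiv.swap_comm b a] at this
    exact (mul_left_cancel this).symm
  have hfix : Equiv.swap e f a = a := by rw [hs, Equiv.swap_apply_of_ne_of_ne h₁ h₂]
  have hae : a ≠ e := by
    rintro rfl
    rw [Equiv.swap_apply_left] at hfix
    exact h'.ne₂ hfix.symm
  have haf : a ≠ f := by
    rintro rfl
    rw [Equiv.swap_apply_right] at hfix
    exact h'.ne₂ hfix
  have e1 := h.eq_add a (σ a)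
  have e2 := h.eq_add (a - 1) (σ a)
  have e3 := h'.eq_add a (σ a)
  have e4 := h'.eq_add (a - 1) (σ a)
  have hj := cycInd_sub_pred a b a
  rw [if_pos rfl, if_neg h.ne₁, cycInd_self_left h.ne₁] at hj
  have hj' : cycInd a b (a - 1) = 0 := by omega
  simp only [rectInd, cycInd_pred_of_ne h₁ h₂, cycInd_pred_of_ne hae haf, cycInd_self_right,
    cycInd_self_left h.ne₁, cycInd_self_left (σ.injective.ne h.ne₁), hj', mul_zero,
    mul_one] at e1 e2 e3 e4
  omega

omit [NeZero n] in
theorem Decomp.apply_eq_of_involutive {σ τ : Equiv.Perm (ZMod n)} {D : ZMod n → ZMod n → ℤ}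
    {a b a' b' : ZMod n} (h : Decomp σ τ D a b a' b') (hστ : σ ≠ τ)
    (hi : ∀ i, τ (σ.symm (τ i)) = σ i) : τ a = σ b := by
  have hτ : ∀ i, τ i = σ (Equiv.swap a b (Equiv.swap a' b' i)) := fun i => by rw [h.target]; rfl
  have hm := (h.moved hστ).1
  have hi' := hi a
  have hpp : Equiv.swap a' b' (Equiv.swap a' b' a) = a := Equiv.swap_apply_self _ _ _
  rw [hτ a] at hm ⊢
  rw [hτ a, Equiv.symm_apply_apply, hτ, σ.injective.eq_iff] at hi'
  rw [Ne, σ.injective.eq_iff] at hm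
  rw [σ.injective.eq_iff]
  by_cases h1 : Equiv.swap a' b' a = a
  · rw [h1, Equiv.swap_apply_left]
  by_cases h2 : Equiv.swap a' b' a = b
  · rw [h2, Equiv.swap_apply_right] at hm
    exact absurd rfl hm
  · rw [Equiv.swap_apply_of_ne_of_ne h1 h2, hpp, Equiv.swap_apply_left] at hi'
    exact absurd hi'.symm h.ne₁

omit [NeZero n] in
theorem swap_mul_swap_comm {a b a' b' : ZMod n} (h₁ : a ≠ a') (h₂ : a ≠ b') (h₃ : b ≠ a')
    (h₄ : b ≠ b') : Equiv.swap a b * Equiv.swap a' b' = Equiv.swap a' b' * Equiv.swap a b := by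
  rw [Equiv.mul_swap_eq_swap_mul, Equiv.swap_apply_of_ne_of_ne h₁.symm h₃.symm,
    Equiv.swap_apply_of_ne_of_ne h₂.symm h₄.symm]

theorem Decomp.hasTwoDecomps_of_disjoint {σ τ : Equiv.Perm (ZMod n)}
    {D : ZMod n → ZMod n → ℤ} {a b a' b' : ZMod n} (h : Decomp σ τ D a b a' b') (hστ : σ ≠ τ)
    (h₁ : a ≠ a') (h₂ : a ≠ b') (h₃ : b ≠ a') (h₄ : b ≠ b') : HasTwoDecomps σ τ D := by
  have h' : Decomp σ τ D a' b' a b := by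
    refine ⟨h.ne₂, h.ne₁, ?_, fun i j => ?_⟩
    · rw [h.target, mul_assoc, swap_mul_swap_comm h₁ h₂ h₃ h₄, mul_assoc]
    · rw [h.eq_add]
      simp only [rectInd, Equiv.Perm.mul_apply, Equiv.swap_apply_of_ne_of_ne h₁ h₂,
        Equiv.swap_apply_of_ne_of_ne h₃ h₄, Equiv.swap_apply_of_ne_of_ne h₁.symm h₃.symm,
        Equiv.swap_apply_of_ne_of_ne h₂.symm h₄.symm]
      ring
  have hτ : ∀ i, τ i = σ (Equiv.swap a b (Equiv.swap a' b' i)) := fun i => by rw [h.target]; rfl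
  have hi : ∀ i, τ (σ.symm (τ i)) = σ i := by
    intro i
    have hc := swap_mul_swap_comm h₁ h₂ h₃ h₄
    have hc' := fun k => Equiv.congr_fun hc k
    simp only [Equiv.Perm.mul_apply] at hc'
    rw [hτ i, Equiv.symm_apply_apply, hτ, hc', Equiv.swap_apply_self,
      Equiv.swap_apply_self]
  refine ⟨a, b, a', b', a', b', a, b, h, h', fun hc => h₁ hc.1, fun e f e' f' he => ?_⟩
  have hf : f = Equiv.swap a b (Equiv.swap a' b' e) := by
    have := he.apply_eq_of_involutive hστ hi
    rw [hτ, σ.injective.eq_iff] at this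
    exact this.symm
  by_cases hea : e = a
  · subst hea
    rw [Equiv.swap_apply_of_ne_of_ne h₁ h₂, Equiv.swap_apply_left] at hf
    exact Or.inl ⟨rfl, hf⟩
  by_cases heb : e = b
  · subst heb
    rw [Equiv.swap_apply_of_ne_of_ne h₃ h₄, Equiv.swap_apply_right] at hf
    subst hf
    exact absurd he (h.not_reverse h₁ h₂)
  by_cases hea' : e = a'
  · subst hea'
    rw [Equiv.swap_apply_left, Equiv.swap_apply_of_ne_of_ne h₂.symm h₄.symm] at hf
    exact Or.inr ⟨rfl, hf⟩
  by_cases heb' : e = b'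
  · subst heb'
    rw [Equiv.swap_apply_right, Equiv.swap_apply_of_ne_of_ne h₁.symm h₃.symm] at hf
    subst hf
    exact absurd he (h'.not_reverse h₁.symm h₃.symm)
  · rw [Equiv.swap_apply_of_ne_of_ne hea' heb', Equiv.swap_apply_of_ne_of_ne hea heb] at hf
    exact absurd hf.symm he.ne₁

omit [NeZero n] in
theorem eq_or_eq_or_eq_of_moved {σ τ : Equiv.Perm (ZMod n)} {x y z p q r s : ZMod n}
    (hτ : τ = σ * Equiv.swap p q * Equiv.swap r s) (hp : p = x ∨ p = y ∨ p = z)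
    (hq : q = x ∨ q = y ∨ q = z) (hr : r = x ∨ r = y ∨ r = z) (hs : s = x ∨ s = y ∨ s = z)
    {i : ZMod n} (hi : τ i ≠ σ i) : i = x ∨ i = y ∨ i = z := by
  by_contra! hc
  apply hi
  obtain ⟨hx, hy, hz⟩ := hc
  have hne : ∀ {u}, (u = x ∨ u = y ∨ u = z) → i ≠ u := by
    rintro u (rfl | rfl | rfl) <;> assumption
  rw [hτ, Equiv.Perm.mul_apply, Equiv.Perm.mul_apply,
    Equiv.swap_apply_of_ne_of_ne (hne hr) (hne hs),
    Equiv.swap_apply_of_ne_of_ne (hne hp) (hne hq)]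

omit [NeZero n] in
theorem swap_mul_swap_left {p q r : ZMod n} (hpr : p ≠ r) (hqr : q ≠ r) :
    Equiv.swap p q * Equiv.swap p r = Equiv.swap q r * Equiv.swap p q := by
  rw [Equiv.mul_swap_eq_swap_mul, Equiv.swap_apply_left,
    Equiv.swap_apply_of_ne_of_ne hpr.symm hqr.symm]

omit [NeZero n] in
theorem swap_mul_swap_right {p q r : ZMod n} (hpr : p ≠ r) (hqr : q ≠ r) :
    Equiv.swap p q * Equiv.swap q r = Equiv.swap p r * Equiv.swap p q := by
  rw [Equiv.mul_swap_eq_swap_mul, Equiv.swap_apply_right,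
    Equiv.swap_apply_of_ne_of_ne hpr.symm hqr.symm]

omit [NeZero n] in
theorem swap_mul_swap_outer {p q r : ZMod n} (hpq : p ≠ q) (hpr : p ≠ r) :
    Equiv.swap p q * Equiv.swap q r = Equiv.swap q r * Equiv.swap p r := by
  rw [Equiv.swap_mul_eq_mul_swap, Equiv.swap_inv, Equiv.swap_apply_left,
    Equiv.swap_apply_of_ne_of_ne hpq hpr]

omit [NeZero n] in
theorem swap_mul_swap_inner {p q r : ZMod n} (hpq : p ≠ q) (hpr : p ≠ r) :
    Equiv.swap p r * Equiv.swap q r = Equiv.swap q r * Equiv.swap p q := by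
  rw [Equiv.swap_mul_eq_mul_swap, Equiv.swap_inv, Equiv.swap_apply_right,
    Equiv.swap_apply_of_ne_of_ne hpq hpr]

omit [NeZero n] in
/-- If only three columns are moved and the corner columns of a rectangle contained in `D` are
limited to those of two given decompositions, then there are no others. -/
theorem hasTwoDecomps_of_three {σ τ : Equiv.Perm (ZMod n)} {D : ZMod n → ZMod n → ℤ}
    {x y z a b a' b' c d c' d' : ZMod n} (hστ : σ ≠ τ) (h₁ : Decomp σ τ D a b a' b')
    (h₂ : Decomp σ τ D c d c' d') (hne : ¬ (a = c ∧ b = d)) (ha : a = x ∨ a = y ∨ a = z)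
    (hb : b = x ∨ b = y ∨ b = z) (ha' : a' = x ∨ a' = y ∨ a' = z) (hb' : b' = x ∨ b' = y ∨ b' = z)
    (H : ∀ e f, e ≠ f → (e = x ∨ e = y ∨ e = z) → (f = x ∨ f = y ∨ f = z) →
      (∀ p q, cycInd e f p * cycInd (σ e) (σ f) (σ q) ≤ D p (σ q)) →
      (e = a ∧ f = b) ∨ (e = c ∧ f = d)) : HasTwoDecomps σ τ D := by
  refine ⟨a, b, a', b', c, d, c', d', h₁, h₂, hne, fun e f e' f' he => ?_⟩
  have hm := he.moved hστ
  exact H e f he.ne₁ (eq_or_eq_or_eq_of_moved h₁.target ha hb ha' hb' hm.1)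
    (eq_or_eq_or_eq_of_moved h₁.target ha hb ha' hb' hm.2) fun p q => he.rectInd_le p (σ q)

/-- The case of an L-shaped domain with missing lower right quadrant. -/
theorem hasTwoDecomps_lowerRight {σ τ : Equiv.Perm (ZMod n)} {D : ZMod n → ZMod n → ℤ}
    {x y z : ZMod n} (hστ : σ ≠ τ) (hc : CycOrd x y z) (hr : CycOrd (σ x) (σ y) (σ z))
    (hτ : τ = σ * Equiv.swap x y * Equiv.swap x z)
    (hD : ∀ i j, D i j =
      cycInd x y i * cycInd (σ x) (σ z) j + cycInd y z i * cycInd (σ y) (σ z) j) :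
    HasTwoDecomps σ τ D := by
  have hxy := hc.ne₁₂
  have hyz := hc.ne₂₃
  have hxz := hc.ne₁₃
  refine hasTwoDecomps_of_three (x := x) (y := y) (z := z) (a := x) (b := y) (a' := x)
    (b' := z) (c := y) (d := z) (c' := x) (d' := y) hστ
    ⟨hxy, hxz, hτ, fun i j => ?_⟩
    ⟨hyz, hxy, by rw [hτ, mul_assoc, swap_mul_swap_left hxz hyz, mul_assoc], fun i j => ?_⟩
    (fun h => hxy h.1) (by simp) (by simp) (by simp) (by simp) fun e f hef he hf hle => ?_
  · simp only [hD, rectInd, Equiv.Perm.mul_apply, Equiv.swap_apply_left,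
      Equiv.swap_apply_of_ne_of_ne hxz.symm hyz.symm, hc.split i, hr.split j]
    ring
  · simp only [hD, rectInd, Equiv.Perm.mul_apply, Equiv.swap_apply_left,
      Equiv.swap_apply_of_ne_of_ne hxy hxz, hr.split j]
    ring
  · have hcv := hc.cycInd_values
    have hrv := hr.cycInd_values
    have p1 := hle x x
    have p2 := hle x y
    have p3 := hle x z
    have p4 := hle y x
    have p5 := hle y y
    have p6 := hle y z
    have p7 := hle z x
    have p8 := hle z y
    have p9 := hle z z
    simp only [hD] at p1 p2 p3 p4 p5 p6 p7 p8 p9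
    rcases he with rfl | rfl | rfl <;> rcases hf with rfl | rfl | rfl <;> simp_all

/-- The case of an L-shaped domain with missing upper left quadrant. -/
theorem hasTwoDecomps_upperLeft {σ τ : Equiv.Perm (ZMod n)} {D : ZMod n → ZMod n → ℤ}
    {x y z : ZMod n} (hστ : σ ≠ τ) (hc : CycOrd x y z) (hr : CycOrd (σ x) (σ y) (σ z))
    (hτ : τ = σ * Equiv.swap x y * Equiv.swap y z)
    (hD : ∀ i j, D i j =
      cycInd x y i * cycInd (σ x) (σ y) j + cycInd y z i * cycInd (σ x) (σ z) j) :
    HasTwoDecomps σ τ D := by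
  have hxy := hc.ne₁₂
  have hyz := hc.ne₂₃
  have hxz := hc.ne₁₃
  refine hasTwoDecomps_of_three (x := x) (y := y) (z := z) (a := x) (b := y) (a' := y)
    (b' := z) (c := y) (d := z) (c' := x) (d' := z) hστ
    ⟨hxy, hyz, hτ, fun i j => ?_⟩
    ⟨hyz, hxz, by rw [hτ, mul_assoc, swap_mul_swap_outer hxy hxz, mul_assoc], fun i j => ?_⟩
    (fun h => hxy h.1) (by simp) (by simp) (by simp) (by simp) fun e f hef he hf hle => ?_
  · simp only [hD, rectInd, Equiv.Perm.mul_apply, Equiv.swap_apply_right,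
      Equiv.swap_apply_of_ne_of_ne hxz.symm hyz.symm, hr.split j]
  · simp only [hD, rectInd, Equiv.Perm.mul_apply, Equiv.swap_apply_right,
      Equiv.swap_apply_of_ne_of_ne hxy hxz, hc.split i, hr.split j]
    ring
  · have hcv := hc.cycInd_values
    have hrv := hr.cycInd_values
    have p1 := hle x x
    have p2 := hle x y
    have p3 := hle x z
    have p4 := hle y x
    have p5 := hle y y
    have p6 := hle y z
    have p7 := hle z x
    have p8 := hle z y
    have p9 := hle z z
    simp only [hD] at p1 p2 p3 p4 p5 p6 p7 p8 p9
    rcases he with rfl | rfl | rfl <;> rcases hf with rfl | rfl | rfl <;> simp_all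

/-- The case of an L-shaped domain with missing upper right quadrant. -/
theorem hasTwoDecomps_upperRight {σ τ : Equiv.Perm (ZMod n)} {D : ZMod n → ZMod n → ℤ}
    {x y z : ZMod n} (hστ : σ ≠ τ) (hc : CycOrd x y z) (hr : CycOrd (σ x) (σ z) (σ y))
    (hτ : τ = σ * Equiv.swap x y * Equiv.swap y z)
    (hD : ∀ i j, D i j =
      cycInd x y i * cycInd (σ x) (σ y) j + cycInd y z i * cycInd (σ x) (σ z) j) :
    HasTwoDecomps σ τ D := by
  have hxy := hc.ne₁₂
  have hyz := hc.ne₂₃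
  have hxz := hc.ne₁₃
  refine hasTwoDecomps_of_three (x := x) (y := y) (z := z) (a := x) (b := y) (a' := y)
    (b' := z) (c := x) (d := z) (c' := x) (d' := y) hστ
    ⟨hxy, hyz, hτ, fun i j => ?_⟩
    ⟨hxz, hxy, by rw [hτ, mul_assoc, swap_mul_swap_right hxz hyz, mul_assoc], fun i j => ?_⟩
    (fun h => hyz h.2) (by simp) (by simp) (by simp) (by simp) fun e f hef he hf hle => ?_
  · simp only [hD, rectInd, Equiv.Perm.mul_apply, Equiv.swap_apply_right,
      Equiv.swap_apply_of_ne_of_ne hxz.symm hyz.symm, hr.split j]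
  · simp only [hD, rectInd, Equiv.Perm.mul_apply, Equiv.swap_apply_left,
      Equiv.swap_apply_of_ne_of_ne hxy.symm hyz, hc.split i, hr.split j]
    ring
  · have hcv := hc.cycInd_values
    have hrv := hr.cycInd_values
    have p1 := hle x x
    have p2 := hle x y
    have p3 := hle x z
    have p4 := hle y x
    have p5 := hle y y
    have p6 := hle y z
    have p7 := hle z x
    have p8 := hle z y
    have p9 := hle z z
    simp only [hD] at p1 p2 p3 p4 p5 p6 p7 p8 p9
    rcases he with rfl | rfl | rfl <;> rcases hf with rfl | rfl | rfl <;> simp_all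

/-- The case of an L-shaped domain with missing lower left quadrant. -/
theorem hasTwoDecomps_lowerLeft {σ τ : Equiv.Perm (ZMod n)} {D : ZMod n → ZMod n → ℤ}
    {x y z : ZMod n} (hστ : σ ≠ τ) (hc : CycOrd x y z) (hr : CycOrd (σ y) (σ x) (σ z))
    (hτ : τ = σ * Equiv.swap x z * Equiv.swap y z)
    (hD : ∀ i j, D i j =
      cycInd x y i * cycInd (σ x) (σ z) j + cycInd y z i * cycInd (σ y) (σ z) j) :
    HasTwoDecomps σ τ D := by
  have hxy := hc.ne₁₂
  have hyz := hc.ne₂₃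
  have hxz := hc.ne₁₃
  refine hasTwoDecomps_of_three (x := x) (y := y) (z := z) (a := x) (b := z) (a' := y)
    (b' := z) (c := y) (d := z) (c' := x) (d' := y) hστ
    ⟨hxz, hyz, hτ, fun i j => ?_⟩
    ⟨hyz, hxy, by rw [hτ, mul_assoc, swap_mul_swap_inner hxy hxz, mul_assoc], fun i j => ?_⟩
    (fun h => hxy h.1) (by simp) (by simp) (by simp) (by simp) fun e f hef he hf hle => ?_
  · simp only [hD, rectInd, Equiv.Perm.mul_apply, Equiv.swap_apply_right,
      Equiv.swap_apply_of_ne_of_ne hxy.symm hyz, hc.split i, hr.split j]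
    ring
  · simp only [hD, rectInd, Equiv.Perm.mul_apply, Equiv.swap_apply_left,
      Equiv.swap_apply_of_ne_of_ne hxy hxz, hr.split j]
    ring
  · have hcv := hc.cycInd_values
    have hrv := hr.cycInd_values
    have p1 := hle x x
    have p2 := hle x y
    have p3 := hle x z
    have p4 := hle y x
    have p5 := hle y y
    have p6 := hle y z
    have p7 := hle z x
    have p8 := hle z y
    have p9 := hle z z
    simp only [hD] at p1 p2 p3 p4 p5 p6 p7 p8 p9
    rcases he with rfl | rfl | rfl <;> rcases hf with rfl | rfl | rfl <;> simp_all

/-- The case of two empty rectangles with a common corner column. -/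
theorem Decomp.hasTwoDecomps_of_shared {σ τ : Equiv.Perm (ZMod n)}
    {D : ZMod n → ZMod n → ℤ} {a b a' b' : ZMod n} (h : Decomp σ τ D a b a' b') (hστ : σ ≠ τ)
    (h₁ : RectEmpty σ a b) (h₂ : RectEmpty (σ * Equiv.swap a b) a' b')
    (hs : a' = a ∨ a' = b ∨ b' = a ∨ b' = b) : HasTwoDecomps σ τ D := by
  have hab := h.ne₁
  have hab' := h.ne₂
  have hτ := h.target
  have hD := h.eq_add
  have hne : Equiv.swap a' b' ≠ Equiv.swap a b := by
    intro hs
    rw [hs, mul_assoc, Equiv.swap_mul_self, mul_one] at hτ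
    exact hστ hτ.symm
  have key : ∀ e, e ≠ a → e ≠ b → (CycOrd a b e ∧ CycOrd (σ a) (σ b) (σ e)) ∨
      (CycOrd a b e ∧ CycOrd (σ a) (σ e) (σ b)) ∨ (CycOrd a e b ∧ CycOrd (σ a) (σ b) (σ e)) := by
    intro e hea heb
    have he := h₁ e hea
    have hc := cycOrd_or_cycOrd hab heb.symm hea.symm
    have hr := cycOrd_or_cycOrd (σ.injective.ne hab) (σ.injective.ne heb.symm)
      (σ.injective.ne hea.symm)
    have : ¬ (CycOrd a e b ∧ CycOrd (σ a) (σ e) (σ b)) := by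
      rintro ⟨hc, hr⟩
      rw [rectInd, hc.cycInd_inner, hr.cycInd_inner] at he
      exact absurd he (by norm_num)
    tauto
  have hwa := h₂ a
  have hwb := h₂ b
  by_cases haa : a' = a
  · subst haa
    have hbb : b' ≠ b := by rintro rfl; exact hne rfl
    have hw := hwb hab.symm
    simp only [rectInd, Equiv.Perm.mul_apply, Equiv.swap_apply_left, Equiv.swap_apply_right,
      Equiv.swap_apply_of_ne_of_ne hab'.symm hbb] at hw hD
    rcases key b' hab'.symm hbb with ⟨hc, hr⟩ | ⟨hc, hr⟩ | ⟨hc, hr⟩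
    · refine hasTwoDecomps_lowerRight hστ hc hr hτ fun i j => ?_
      rw [hD, hc.split, hr.split]
      ring
    · simp [hc.cycInd_values, hr.cycInd_values] at hw
    · refine hasTwoDecomps_upperRight hστ hc hr ?_ fun i j => ?_
      · rw [hτ, mul_assoc, mul_assoc, swap_mul_swap_right hab hbb]
      · rw [hD, hc.split, hr.split]
        ring
  by_cases hbb : b' = b
  · subst hbb
    have hw := hwa (Ne.symm haa)
    simp only [rectInd, Equiv.Perm.mul_apply, Equiv.swap_apply_left, Equiv.swap_apply_right,
      Equiv.swap_apply_of_ne_of_ne haa hab'] at hw hD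
    rcases key a' haa hab' with ⟨hc, hr⟩ | ⟨hc, hr⟩ | ⟨hc, hr⟩
    · refine hasTwoDecomps_upperLeft hστ hc.rotate.rotate hr.rotate.rotate ?_ fun i j => ?_
      · rw [hτ, mul_assoc, mul_assoc, swap_mul_swap_outer haa hab']
      · rw [hD, hc.rotate.rotate.split, hr.rotate.rotate.split]
        ring
    · simp [hc.cycInd_values, hr.cycInd_values] at hw
    · refine hasTwoDecomps_lowerLeft hστ hc hr.rotate.rotate hτ fun i j => ?_
      rw [hD, hc.split, hr.rotate.rotate.split]
      ring
  by_cases hba : b' = a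
  · subst hba
    have ha'b : a' ≠ b := by rintro rfl; exact hne (Equiv.swap_comm _ _)
    have hw := hwb ha'b.symm
    simp only [rectInd, Equiv.Perm.mul_apply, Equiv.swap_apply_left, Equiv.swap_apply_right,
      Equiv.swap_apply_of_ne_of_ne haa ha'b] at hw hD
    rcases key a' haa ha'b with ⟨hc, hr⟩ | ⟨hc, hr⟩ | ⟨hc, hr⟩
    · refine hasTwoDecomps_lowerRight hστ hc.rotate.rotate hr.rotate.rotate ?_ fun i j => ?_
      · rw [hτ, mul_assoc, mul_assoc, swap_mul_swap_left ha'b hab]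
      · rw [hD, hr.rotate.rotate.split]
        ring
    · refine hasTwoDecomps_lowerLeft hστ hc.rotate.rotate hr ?_ fun i j => ?_
      · rw [hτ, mul_assoc, mul_assoc, swap_mul_swap_inner haa ha'b]
      · rw [hD, hr.split]
        ring
    · simp [hc.cycInd_values, hr.cycInd_values] at hw
  · have hba' : a' = b := by tauto
    subst hba'
    have hw := hwa hab
    simp only [rectInd, Equiv.Perm.mul_apply, Equiv.swap_apply_left, Equiv.swap_apply_right,
      Equiv.swap_apply_of_ne_of_ne hba hbb] at hw hD
    rcases key b' hba hbb with ⟨hc, hr⟩ | ⟨hc, hr⟩ | ⟨hc, hr⟩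
    · refine hasTwoDecomps_upperLeft hστ hc hr hτ fun i j => ?_
      exact hD i j
    · refine hasTwoDecomps_upperRight hστ hc hr hτ fun i j => ?_
      exact hD i j
    · simp [hc.cycInd_values, hr.cycInd_values] at hw

theorem HasTwoDecomps.card_eq_two {σ τ : Equiv.Perm (ZMod n)} {D : ZMod n → ZMod n → ℤ}
    (h : HasTwoDecomps σ τ D) :
    Nat.card
      {t : Equiv.Perm (ZMod n) × (ZMod n → ZMod n → ℤ) × (ZMod n → ZMod n → ℤ) //
        IsRectangle n σ t.1 t.2.1 ∧ IsRectangle n t.1 τ t.2.2 ∧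
        ∀ i j, D i j = t.2.1 i j + t.2.2 i j} = 2 := by
  obtain ⟨a, b, a', b', c, d, c', d', h₁, h₂, hne, huniq⟩ := h
  have mem : ∀ {p q p' q' : ZMod n}, Decomp σ τ D p q p' q' →
      IsRectangle n σ (σ * Equiv.swap p q) (rectInd σ p q) ∧
      IsRectangle n (σ * Equiv.swap p q) τ (rectInd (σ * Equiv.swap p q) p' q') ∧
      ∀ i j, D i j = rectInd σ p q i j + rectInd (σ * Equiv.swap p q) p' q' i j :=
    fun h => ⟨isRectangle_rectInd σ h.ne₁, h.target ▸ isRectangle_rectInd _ h.ne₂, h.eq_add⟩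
  rw [Nat.card_eq_two_iff]
  refine ⟨⟨(_, _, _), mem h₁⟩, ⟨(_, _, _), mem h₂⟩, ?_, ?_⟩
  · intro he
    exact hne (rectInd_inj h₁.ne₁ (congrArg (fun t => t.1.2.1) he))
  · rw [Set.eq_univ_iff_forall]
    rintro ⟨⟨w, R, S⟩, hR, hS, hRS⟩
    obtain ⟨e, f, hef, hw, hRe⟩ := hR.exists_rectInd
    obtain ⟨e', f', hef', hτ, hSe⟩ := hS.exists_rectInd
    simp only at hw hRe hτ hSe hRS
    subst hw hRe hSe
    have ext : ∀ {p q p' q' : ZMod n}, Decomp σ τ D p q p' q' → e = p ∧ f = q →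
        (σ * Equiv.swap e f, rectInd σ e f, rectInd (σ * Equiv.swap e f) e' f') =
          (σ * Equiv.swap p q, rectInd σ p q, rectInd (σ * Equiv.swap p q) p' q') := by
      rintro p q p' q' h ⟨rfl, rfl⟩
      refine Prod.ext rfl (Prod.ext rfl ?_)
      funext i j
      exact add_left_cancel ((hRS i j).symm.trans (h.eq_add i j))
    rcases huniq e f e' f' ⟨hef, hef', hτ, hRS⟩ with h | h
    · exact Or.inl (Subtype.ext (ext h₁ h))
    · exact Or.inr (Subtype.ext (ext h₂ h))

end Decompositions

/-- Every positive domain of Maslov index 2 connecting two distinct grid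
states decomposes as a concatenation of two rectangles in exactly two ways: there are
exactly two triples `(w, R₁, R₂)` with `R₁` a rectangle from `x` to `w`, `R₂` a
rectangle from `w` to `y`, and `D = R₁ + R₂`. -/
theorem stmt_12 (n : ℕ) [NeZero n] (hn : 2 ≤ n) (σ τ : Equiv.Perm (ZMod n))
    (hστ : σ ≠ τ) (D : ZMod n → ZMod n → ℤ) (hD : IsGridDomain n σ τ D)
    (hpos : ∀ i j, 0 ≤ D i j) (hμ : maslov n σ τ D = 2) :
    Nat.card
      {t : Equiv.Perm (ZMod n) × (ZMod n → ZMod n → ℤ) × (ZMod n → ZMod n → ℤ) //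
        IsRectangle n σ t.1 t.2.1 ∧ IsRectangle n t.1 τ t.2.2 ∧
        ∀ i j, D i j = t.2.1 i j + t.2.2 i j} = 2 := by
  obtain ⟨a, b, a2, b2, h, h₁, h₂⟩ := hD.exists_decomp hn hpos hστ hμ
  by_cases hs : a2 = a ∨ a2 = b ∨ b2 = a ∨ b2 = b
  · exact (h.hasTwoDecomps_of_shared hστ h₁ h₂ hs).card_eq_two
  · push Not at hs
    obtain ⟨k₁, k₂, k₃, k₄⟩ := hs
    exact (h.hasTwoDecomps_of_disjoint hστ k₁.symm k₃.symm k₂.symm k₄.symm).card_eq_two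
end

section
/- For n ≥ 2, every positive domain D of Maslov index 2 from a grid state x to itself in the toroidal grid of size n is a thin annulus, i.e. the indicator function of a single row (ℤ/nℤ) × {j₀} or of a single column {i₀} × (ℤ/nℤ) of squares; moreover each such thin annulus admits exactly one decomposition as a concatenation of two rectangles, i.e. there is exactly one triple (w, R₁, R₂) with w a grid state, R₁ a rectangle from x to w, R₂ a rectangle from w to x, and D = R₁ + R₂. -/
namespace GridDomain

variable {n : ℕ}

theorem apply_eq_apply_zero [NeZero n] {α : Type*} {g : ZMod n → α}
    (h : ∀ j, g j = g (j - 1)) (j : ZMod n) : g j = g 0 := by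
  have key : ∀ k : ℕ, g (k : ZMod n) = g 0 := by
    intro k
    induction k with
    | zero => simp
    | succ k ih =>
      rw [h, ← ih]
      congr 1
      push_cast
      ring
  simpa using key j.val

theorem exists_eq_ite_of_sum_eq_one {ι : Type*} [Fintype ι] [DecidableEq ι] {a : ι → ℤ}
    (ha : ∀ i, 0 ≤ a i) (hs : ∑ i, a i = 1) : ∃ i₀, ∀ i, a i = if i = i₀ then 1 else 0 := by
  obtain ⟨i₀, -, h₀⟩ : ∃ i ∈ Finset.univ, a i ≠ 0 :=
    Finset.exists_ne_zero_of_sum_ne_zero (by rw [hs]; exact one_ne_zero)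
  have hsplit := Finset.add_sum_erase Finset.univ a (Finset.mem_univ i₀)
  have hnn : 0 ≤ ∑ i ∈ Finset.univ.erase i₀, a i := Finset.sum_nonneg fun i _ => ha i
  have hp := ha i₀
  have hz : ∑ i ∈ Finset.univ.erase i₀, a i = 0 := by omega
  refine ⟨i₀, fun i => ?_⟩
  split_ifs with h
  · subst h; omega
  · exact (Finset.sum_eq_zero_iff_of_nonneg fun i _ => ha i).1 hz i (by simp [h])

/-- A positive periodic domain is a nonnegative combination of rows and columns. -/
theorem exists_nonneg_add [NeZero n] {σ : Equiv.Perm (ZMod n)} {D : ZMod n → ZMod n → ℤ}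
    (hD : IsGridDomain n σ σ D) (hpos : ∀ i j, 0 ≤ D i j) :
    ∃ a b : ZMod n → ℤ, (∀ i, 0 ≤ a i) ∧ (∀ j, 0 ≤ b j) ∧ ∀ i j, D i j = a i + b j := by
  obtain ⟨c, hc⟩ := Finite.exists_min (D 0)
  refine ⟨fun i => D i c, fun j => D 0 j - D 0 c, fun i => hpos i c,
    fun j => sub_nonneg.2 (hc j), fun i j => ?_⟩
  have hcol : ∀ i j, D i j - D (i - 1) j = D i 0 - D (i - 1) 0 := fun i =>
    apply_eq_apply_zero (g := fun j => D i j - D (i - 1) j) fun j => by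
      have := hD i j
      grind
  have hrow := apply_eq_apply_zero (g := fun i => D i j - D i c)
    (fun i => by have := hcol i j; have := hcol i c; grind) i
  grind

theorem maslov_add [NeZero n] (σ : Equiv.Perm (ZMod n)) {D : ZMod n → ZMod n → ℤ}
    {a b : ZMod n → ℤ} (h : ∀ i j, D i j = a i + b j) :
    maslov n σ σ D = 2 * ((∑ i, a i + ∑ j, b j : ℤ) : ℚ) := by
  have e₁ : ∑ i : ZMod n, (a (i - 1) : ℚ) = ∑ i, (a i : ℚ) :=
    Equiv.sum_comp (Equiv.subRight (1 : ZMod n)) fun i => (a i : ℚ)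
  have e₂ : ∑ i, (b (σ i) : ℚ) = ∑ j, (b j : ℚ) := Equiv.sum_comp σ fun j => (b j : ℚ)
  have e₃ : ∑ i, (b (σ i - 1) : ℚ) = ∑ j, (b j : ℚ) :=
    Equiv.sum_comp (σ.trans (Equiv.subRight (1 : ZMod n))) fun j => (b j : ℚ)
  have key : ∑ i, ptMeasure n D i (σ i) = ∑ i, (a i : ℚ) + ∑ j, (b j : ℚ) := by
    have hpt : ∀ i, ptMeasure n D i (σ i) =
        (a i + a (i - 1) + b (σ i) + b (σ i - 1) : ℚ) / 2 := fun i => by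
      simp only [ptMeasure, h]
      push_cast
      ring
    simp only [hpt]
    rw [← Finset.sum_div]
    simp only [Finset.sum_add_distrib, e₁, e₂, e₃]
    ring
  rw [maslov, key]
  push_cast
  ring

/-- A positive domain of Maslov index 2 from a grid state to itself is a thin annulus. -/
theorem eq_row_or_column [NeZero n] {σ : Equiv.Perm (ZMod n)} {D : ZMod n → ZMod n → ℤ}
    (hD : IsGridDomain n σ σ D) (hpos : ∀ i j, 0 ≤ D i j) (hμ : maslov n σ σ D = 2) :
    (∃ j₀ : ZMod n, ∀ i j : ZMod n, D i j = if j = j₀ then 1 else 0) ∨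
      (∃ i₀ : ZMod n, ∀ i j : ZMod n, D i j = if i = i₀ then 1 else 0) := by
  obtain ⟨a, b, ha, hb, h⟩ := exists_nonneg_add hD hpos
  rw [maslov_add σ h] at hμ
  have hs : ∑ i, a i + ∑ j, b j = 1 := by
    have : ((∑ i, a i + ∑ j, b j : ℤ) : ℚ) = 1 := by linarith
    exact_mod_cast this
  have hsa : 0 ≤ ∑ i, a i := Finset.sum_nonneg fun i _ => ha i
  have hsb : 0 ≤ ∑ j, b j := Finset.sum_nonneg fun j _ => hb j
  rcases (by omega : (∑ i, a i = 0 ∧ ∑ j, b j = 1) ∨ (∑ i, a i = 1 ∧ ∑ j, b j = 0)) with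
    ⟨h₀, h₁⟩ | ⟨h₁, h₀⟩
  · obtain ⟨j₀, hj⟩ := exists_eq_ite_of_sum_eq_one hb h₁
    have hz := (Finset.sum_eq_zero_iff_of_nonneg fun i _ => ha i).1 h₀
    exact .inl ⟨j₀, fun i j => by rw [h, hz i (Finset.mem_univ i), hj, zero_add]⟩
  · obtain ⟨i₀, hi⟩ := exists_eq_ite_of_sum_eq_one ha h₁
    have hz := (Finset.sum_eq_zero_iff_of_nonneg fun j _ => hb j).1 h₀
    exact .inr ⟨i₀, fun i j => by rw [h, hz j (Finset.mem_univ j), hi, add_zero]⟩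

/-- The cyclic interval `{p, p + 1, …, q - 1}`. -/
def arc (p q : ZMod n) : Set (ZMod n) := {j | (j - p).val < (q - p).val}

theorem mem_arc {p q j : ZMod n} : j ∈ arc p q ↔ (j - p).val < (q - p).val := Iff.rfl

theorem val_sub_eq_ite [NeZero n] (a b : ZMod n) :
    (a - b).val = if b.val ≤ a.val then a.val - b.val else a.val + n - b.val := by
  split_ifs with h
  · exact ZMod.val_sub h
  · have ha := ZMod.val_lt a
    have hb := ZMod.val_lt b
    have : a - b = ((a.val + n - b.val : ℕ) : ZMod n) := by
      rw [Nat.cast_sub (by omega)]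
      simp
    rw [this, ZMod.val_natCast, Nat.mod_eq_of_lt (by omega)]

theorem right_notMem_arc (p q : ZMod n) : q ∉ arc p q := lt_irrefl (q - p).val

theorem mem_arc_swap [NeZero n] {p q : ZMod n} (h : p ≠ q) (j : ZMod n) :
    j ∈ arc q p ↔ j ∉ arc p q := by
  have hv : p.val ≠ q.val := fun e => h (ZMod.val_injective n e)
  have := ZMod.val_lt p
  have := ZMod.val_lt q
  have := ZMod.val_lt j
  simp only [mem_arc, val_sub_eq_ite]
  split_ifs <;> omega

theorem isCyclicInterval_arc [NeZero n] {p q : ZMod n} (h : p ≠ q) :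
    IsCyclicInterval n (arc p q) := by
  have hd : 0 < (q - p).val := ZMod.val_pos.2 (sub_ne_zero.2 h.symm)
  refine ⟨p, (q - p).val - 1, Set.ext fun j => ⟨fun hj => ?_, ?_⟩⟩
  · exact ⟨(j - p).val, Nat.le_sub_one_of_lt hj, by simp⟩
  · rintro ⟨m, hm, rfl⟩
    have := ZMod.val_lt (q - p)
    rw [mem_arc, add_sub_cancel_left, ZMod.val_natCast, Nat.mod_eq_of_lt (by omega)]
    omega

open Classical in
theorem arc_indicator_sub [NeZero n] (hn : 2 ≤ n) {p q : ZMod n} (h : p ≠ q) (j : ZMod n) :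
    ((if j ∈ arc p q then 1 else 0) - (if j - 1 ∈ arc p q then 1 else 0) : ℤ) =
      (if j = p then 1 else 0) - (if j = q then 1 else 0) := by
  have : Fact (1 < n) := ⟨hn⟩
  have hp : j = p ↔ (j - p).val = 0 := by rw [ZMod.val_eq_zero, sub_eq_zero]
  have hq : j = q ↔ (j - p).val = (q - p).val := by
    rw [(ZMod.val_injective n).eq_iff, sub_left_inj]
  have hd : 0 < (q - p).val := ZMod.val_pos.2 (sub_ne_zero.2 h.symm)
  have := ZMod.val_lt (q - p)
  have := ZMod.val_lt (j - p)
  have hs : (j - 1 - p).val = if 1 ≤ (j - p).val then (j - p).val - 1 else (j - p).val + n - 1 := by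
    rw [sub_right_comm, val_sub_eq_ite, ZMod.val_one]
  simp only [mem_arc, hp, hq, hs]
  split_ifs <;> omega

open Classical in
/-- The rectangle of width one in the column `i₀` with rows in `arc p q`. -/
noncomputable def columnRect (i₀ p q : ZMod n) (i j : ZMod n) : ℤ :=
  if i = i₀ ∧ j ∈ arc p q then 1 else 0

theorem add_one_ne_self (hn : 2 ≤ n) (i : ZMod n) : i + 1 ≠ i := by
  have : Fact (1 < n) := ⟨hn⟩
  simp

theorem isRectangle_columnRect [NeZero n] (hn : 2 ≤ n) (σ : Equiv.Perm (ZMod n)) (i₀ : ZMod n) :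
    IsRectangle n σ (σ * Equiv.swap i₀ (i₀ + 1)) (columnRect i₀ (σ i₀) (σ (i₀ + 1))) := by
  have hne := add_one_ne_self hn i₀
  have hσ : σ i₀ ≠ σ (i₀ + 1) := σ.injective.ne hne.symm
  refine ⟨fun i j => ?_, {i₀}, arc (σ i₀) (σ (i₀ + 1)), ⟨i₀, 0, ?_⟩, isCyclicInterval_arc hσ,
    fun h => ?_, fun h => ?_, fun i j => ?_⟩
  · have harc := arc_indicator_sub hn hσ j
    have hsub : i - 1 = i₀ ↔ i = i₀ + 1 := sub_eq_iff_eq_add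
    simp only [columnRect, hsub, Equiv.Perm.mul_apply, Equiv.swap_apply_def]
    grind
  · ext b
    simp
  · exact hne (h ▸ Set.mem_univ (i₀ + 1) : i₀ + 1 ∈ ({i₀} : Set (ZMod n)))
  · exact right_notMem_arc _ _ (h ▸ Set.mem_univ (σ (i₀ + 1)))
  · classical simp [columnRect, Set.indicator_apply]

theorem columnRect_add_columnRect [NeZero n] (i₀ : ZMod n) {p q : ZMod n} (h : p ≠ q)
    (i j : ZMod n) :
    columnRect i₀ p q i j + columnRect i₀ q p i j = if i = i₀ then 1 else 0 := by
  have := mem_arc_swap h j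
  simp only [columnRect]
  grind

theorem IsCyclicInterval.nonempty {S : Set (ZMod n)} (h : IsCyclicInterval n S) : S.Nonempty := by
  obtain ⟨a, k, rfl⟩ := h
  exact ⟨a, 0, Nat.zero_le k, by simp⟩

/-- A rectangle supported in the column `i₀` is determined by its initial grid state. -/
theorem eq_columnRect [NeZero n] (hn : 2 ≤ n) {σ w : Equiv.Perm (ZMod n)} {i₀ : ZMod n}
    {R : ZMod n → ZMod n → ℤ} (hR : IsRectangle n σ w R) (hsupp : ∀ i j, i ≠ i₀ → R i j = 0) :
    w = σ * Equiv.swap i₀ (i₀ + 1) ∧ R = columnRect i₀ (σ i₀) (σ (i₀ + 1)) := by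
  obtain ⟨hdom, I, J, hI, hJ, -, hJu, hRI⟩ := hR
  have hne := add_one_ne_self hn i₀
  have hσ : σ i₀ ≠ σ (i₀ + 1) := σ.injective.ne hne.symm
  have hpred : i₀ - 1 ≠ i₀ := fun h => hne (sub_eq_iff_eq_add.1 h).symm
  obtain ⟨i, hi⟩ := IsCyclicInterval.nonempty hI
  obtain ⟨j₁, hj₁⟩ := IsCyclicInterval.nonempty hJ
  obtain ⟨j₂, hj₂⟩ := (Set.ne_univ_iff_exists_notMem J).1 hJu
  have hone : R i j₁ = 1 := by simp [hRI, hi, hj₁]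
  obtain rfl : i = i₀ := by
    by_contra h
    simp [hsupp i j₁ h] at hone
  have hzero : R i j₂ = 0 := by simp [hRI, hj₂]
  have hstep : ∀ j, R i j - R i (j - 1) =
      (if j = σ i then 1 else 0) - (if j = w i then 1 else 0) := fun j => by
    have := hdom i j
    rw [hsupp _ j hpred, hsupp _ (j - 1) hpred] at this
    omega
  have hstep' : ∀ j, R i (j - 1) - R i j =
      (if j = σ (i + 1) then 1 else 0) - (if j = w (i + 1) then 1 else 0) := fun j => by
    have := hdom (i + 1) j
    rw [hsupp _ j hne, hsupp _ (j - 1) hne, add_sub_cancel_right] at this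
    omega
  have hwi : w i ≠ σ i := fun h => by
    have hconst := apply_eq_apply_zero (g := R i) fun j => by
      have := hstep j
      rw [h] at this
      omega
    rw [hconst] at hone hzero
    omega
  have hw₁ : w i = σ (i + 1) := by
    have h₁ := hstep (w i)
    have h₂ := hstep' (w i)
    grind
  have hw₂ : w (i + 1) = σ i := by
    have h₁ := hstep (σ i)
    have h₂ := hstep' (σ i)
    grind
  have hw₃ : ∀ k, k ≠ i → k ≠ i + 1 → w k = σ k := fun k hk hk' => by
    have hk'' : k - 1 ≠ i := fun h => hk' (sub_eq_iff_eq_add.1 h)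
    have := hdom k (w k)
    rw [hsupp _ _ hk, hsupp _ _ hk, hsupp _ _ hk'', hsupp _ _ hk''] at this
    grind
  refine ⟨?_, ?_⟩
  · ext1 k
    simp only [Equiv.Perm.mul_apply, Equiv.swap_apply_def]
    split_ifs with h h'
    · rw [h, hw₁]
    · rw [h', hw₂]
    · exact hw₃ k h h'
  · classical
    have hdiff := apply_eq_apply_zero
      (g := fun j => R i j - if j ∈ arc (σ i) (σ (i + 1)) then 1 else 0) fun j => by
        have h₁ := hstep j
        have h₂ := arc_indicator_sub hn hσ j
        rw [hw₁, ← h₂] at h₁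
        linarith
    have hconst : R i 0 - (if (0 : ZMod n) ∈ arc (σ i) (σ (i + 1)) then 1 else 0) = 0 := by
      have d₁ := hdiff j₁
      have d₂ := hdiff j₂
      rw [hone] at d₁
      rw [hzero] at d₂
      generalize R i 0 - _ = c at d₁ d₂
      split_ifs at d₁ d₂ <;> omega
    funext k j
    by_cases hk : k = i
    · have := (hdiff j).trans hconst
      simpa [columnRect, hk, sub_eq_zero] using this
    · simp [columnRect, hk, hsupp k j hk]

/-- The decompositions of `D` as a concatenation of a rectangle from `σ` to some grid state and a
rectangle back to `σ`. -/
abbrev Decomposition (n : ℕ) (σ : Equiv.Perm (ZMod n)) (D : ZMod n → ZMod n → ℤ) : Type :=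
  {t : Equiv.Perm (ZMod n) × (ZMod n → ZMod n → ℤ) × (ZMod n → ZMod n → ℤ) //
    IsRectangle n σ t.1 t.2.1 ∧ IsRectangle n t.1 σ t.2.2 ∧ ∀ i j, D i j = t.2.1 i j + t.2.2 i j}

theorem IsRectangle.nonneg {σ τ : Equiv.Perm (ZMod n)} {R : ZMod n → ZMod n → ℤ}
    (h : IsRectangle n σ τ R) (i j : ZMod n) : 0 ≤ R i j := by
  obtain ⟨-, I, J, -, -, -, -, hR⟩ := h
  rw [hR]
  exact Set.indicator_nonneg (fun _ _ => zero_le_one) _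

theorem card_decomposition_column [NeZero n] (hn : 2 ≤ n) (σ : Equiv.Perm (ZMod n))
    {D : ZMod n → ZMod n → ℤ} {i₀ : ZMod n} (hD : ∀ i j, D i j = if i = i₀ then 1 else 0) :
    Nat.card (Decomposition n σ D) = 1 := by
  rw [Nat.card_eq_one_iff_unique]
  refine ⟨⟨?_⟩, ?_⟩
  · have key : ∀ t : Decomposition n σ D, t.1 = (σ * Equiv.swap i₀ (i₀ + 1),
        columnRect i₀ (σ i₀) (σ (i₀ + 1)), D - columnRect i₀ (σ i₀) (σ (i₀ + 1))) := by
      rintro ⟨⟨w, R₁, R₂⟩, h₁, h₂, h⟩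
      dsimp only at h₁ h₂ h ⊢
      obtain ⟨rfl, rfl⟩ := eq_columnRect hn h₁ fun i j hi => by
        have := h i j
        rw [hD, if_neg hi] at this
        have := IsRectangle.nonneg h₁ i j
        have := IsRectangle.nonneg h₂ i j
        omega
      have : D = columnRect i₀ (σ i₀) (σ (i₀ + 1)) + R₂ := funext₂ h
      rw [this, add_sub_cancel_left]
    exact fun s t => Subtype.ext ((key s).trans (key t).symm)
  · have h₂ := isRectangle_columnRect hn (σ * Equiv.swap i₀ (i₀ + 1)) i₀
    rw [mul_assoc, Equiv.swap_mul_self, mul_one, Equiv.Perm.mul_apply, Equiv.Perm.mul_apply,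
      Equiv.swap_apply_left, Equiv.swap_apply_right] at h₂
    refine ⟨⟨(σ * Equiv.swap i₀ (i₀ + 1), columnRect i₀ (σ i₀) (σ (i₀ + 1)),
      columnRect i₀ (σ (i₀ + 1)) (σ i₀)), isRectangle_columnRect hn σ i₀, h₂, fun i j => ?_⟩⟩
    rw [hD, columnRect_add_columnRect _ (σ.injective.ne (add_one_ne_self hn i₀).symm)]

theorem IsRectangle.transpose {σ τ : Equiv.Perm (ZMod n)} {R : ZMod n → ZMod n → ℤ}
    (h : IsRectangle n σ τ R) : IsRectangle n σ⁻¹ τ⁻¹ (fun i j => R j i) := by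
  obtain ⟨hdom, I, J, hI, hJ, hIu, hJu, hR⟩ := h
  refine ⟨fun i j => ?_, J, I, hJ, hI, hJu, hIu, fun i j => ?_⟩
  · have := hdom j i
    simp only [Equiv.Perm.eq_inv_iff_eq, eq_comm (b := i)]
    linarith
  · classical simp only [hR, Set.indicator_apply, Set.mem_prod, and_comm, Pi.one_apply]

/-- Exchanging the two coordinates of the torus turns decompositions into decompositions. -/
def Decomposition.transpose (σ : Equiv.Perm (ZMod n)) (D : ZMod n → ZMod n → ℤ) :
    Decomposition n σ D ≃ Decomposition n σ⁻¹ (fun i j => D j i) where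
  toFun t := ⟨(t.1.1⁻¹, fun i j => t.1.2.1 j i, fun i j => t.1.2.2 j i),
    IsRectangle.transpose t.2.1, IsRectangle.transpose t.2.2.1, fun i j => t.2.2.2 j i⟩
  invFun t := ⟨(t.1.1⁻¹, fun i j => t.1.2.1 j i, fun i j => t.1.2.2 j i),
    by simpa using IsRectangle.transpose t.2.1, by simpa using IsRectangle.transpose t.2.2.1,
    fun i j => t.2.2.2 j i⟩
  left_inv t := by simp
  right_inv t := by simp

theorem card_decomposition_row [NeZero n] (hn : 2 ≤ n) (σ : Equiv.Perm (ZMod n))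
    {D : ZMod n → ZMod n → ℤ} {j₀ : ZMod n} (hD : ∀ i j, D i j = if j = j₀ then 1 else 0) :
    Nat.card (Decomposition n σ D) = 1 := by
  rw [Nat.card_congr (Decomposition.transpose σ D)]
  exact card_decomposition_column hn σ⁻¹ fun i j => hD j i

end GridDomain

/-- Every positive domain `D` of Maslov index 2 from a grid state `x`
(given by `σ`) to itself is a thin annulus — the indicator function of a single row
`(ℤ/n) × {j₀}` or a single column `{i₀} × (ℤ/n)` of squares — and it admits exactly one
decomposition as a concatenation of two rectangles, i.e. there is exactly one triple
`(w, R₁, R₂)` with `R₁` a rectangle from `x` to `w`, `R₂` a rectangle from `w` to `x`,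
and `D = R₁ + R₂`. -/
theorem stmt_13 (n : ℕ) [NeZero n] (hn : 2 ≤ n) (σ : Equiv.Perm (ZMod n))
    (D : ZMod n → ZMod n → ℤ) (hD : IsGridDomain n σ σ D)
    (hpos : ∀ i j, 0 ≤ D i j) (hμ : maslov n σ σ D = 2) :
    ((∃ j₀ : ZMod n, ∀ i j : ZMod n, D i j = if j = j₀ then 1 else 0) ∨
      (∃ i₀ : ZMod n, ∀ i j : ZMod n, D i j = if i = i₀ then 1 else 0)) ∧
    Nat.card
      {t : Equiv.Perm (ZMod n) × (ZMod n → ZMod n → ℤ) × (ZMod n → ZMod n → ℤ) //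
        IsRectangle n σ t.1 t.2.1 ∧ IsRectangle n t.1 σ t.2.2 ∧
        ∀ i j, D i j = t.2.1 i j + t.2.2 i j} = 1 := by
  have hthin := GridDomain.eq_row_or_column hD hpos hμ
  refine ⟨hthin, ?_⟩
  obtain ⟨j₀, h⟩ | ⟨i₀, h⟩ := hthin
  · exact GridDomain.card_decomposition_row hn σ h
  · exact GridDomain.card_decomposition_column hn σ h
end

section
/- The quotient of the symmetric square of ℂ by translation of real parts is homeomorphic to ℝ³: the quotient topological space of ℂ × ℂ by the equivalence relation generated by (z₁, z₂) ∼ (z₂, z₁) and (z₁, z₂) ∼ (z₁ + t, z₂ + t) for all t ∈ ℝ is homeomorphic to ℝ³. -/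
/-- The relation on `ℂ × ℂ` generated by coordinate swap and simultaneous translation
of the real parts; its quotient is `Sym²(ℂ)/ℝ`. -/
def SymTransRel (p q : ℂ × ℂ) : Prop :=
  (q = (p.2, p.1)) ∨ ∃ t : ℝ, q = (p.1 + t, p.2 + t)

/-- Squaring is an open map of the complex plane. -/
theorem isOpenMap_complex_sq : IsOpenMap fun w : ℂ => w ^ 2 := by
  have h : AnalyticOnNhd ℂ (fun w : ℂ => w ^ 2) Set.univ := fun w _ => by fun_prop
  rcases h.is_constant_or_isOpen isPreconnected_univ with ⟨c, hc⟩ | h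
  · have h0 := hc 0 trivial
    have h1 := hc 1 trivial
    norm_num at h0 h1
    exact absurd (h0.trans h1.symm) zero_ne_one
  · exact fun s hs => h s (Set.subset_univ s) hs

/-- The invariants of an unordered pair of complex numbers up to real translation: the imaginary
part of the sum and the square of the difference. -/
noncomputable def symTransInvariant (p : ℂ × ℂ) : ℝ × ℂ :=
  ((p.1 + p.2).im, (p.1 - p.2) ^ 2)

theorem continuous_symTransInvariant : Continuous symTransInvariant := by
  unfold symTransInvariant
  fun_prop

theorem symTransInvariant_surjective : Function.Surjective symTransInvariant := by
  rintro ⟨a, b⟩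
  obtain ⟨w, rfl⟩ := IsAlgClosed.exists_pow_nat_eq b two_pos
  refine ⟨((a * Complex.I + w) / 2, (a * Complex.I - w) / 2), Prod.ext ?_ ?_⟩
  · change ((a * Complex.I + w) / 2 + (a * Complex.I - w) / 2).im = a
    rw [show (a * Complex.I + w) / 2 + (a * Complex.I - w) / 2 = a * Complex.I by ring]
    simp
  · change ((a * Complex.I + w) / 2 - (a * Complex.I - w) / 2) ^ 2 = w ^ 2
    ring

/-- The linear change of coordinates `(z₁, z₂) ↦ (z₁ + z₂, z₁ - z₂)`. -/
noncomputable def sumDiffHomeomorph : ℂ × ℂ ≃ₜ ℂ × ℂ where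
  toFun p := (p.1 + p.2, p.1 - p.2)
  invFun p := ((p.1 + p.2) / 2, (p.1 - p.2) / 2)
  left_inv p := by ext1 <;> ring
  right_inv p := by ext1 <;> ring
  continuous_toFun := by fun_prop
  continuous_invFun := by fun_prop

theorem isOpenMap_symTransInvariant : IsOpenMap symTransInvariant :=
  (Complex.isOpenMap_im.prodMap isOpenMap_complex_sq).comp sumDiffHomeomorph.isOpenMap

theorem SymTransRel.symTransInvariant_eq {p q : ℂ × ℂ} (h : SymTransRel p q) :
    symTransInvariant p = symTransInvariant q := by
  rcases h with rfl | ⟨t, rfl⟩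
  · simp only [symTransInvariant, Prod.mk.injEq]
    exact ⟨by rw [add_comm], by ring⟩
  · simp [symTransInvariant]

/-- Pairs with equal imaginary parts of the sum and equal differences are translates. -/
theorem SymTransRel.of_sub_eq {p q : ℂ × ℂ} (him : (p.1 + p.2).im = (q.1 + q.2).im)
    (hsub : p.1 - p.2 = q.1 - q.2) : SymTransRel p q := by
  have him' : (p.1 - p.2).im = (q.1 - q.2).im := by rw [hsub]
  simp only [Complex.add_im, Complex.sub_im] at him him'
  have hfst : q.1 = p.1 + ((q.1 - p.1).re : ℝ) := by
    apply Complex.ext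
    · simp
    · simp only [Complex.add_im, Complex.ofReal_im]
      linarith
  exact Or.inr ⟨(q.1 - p.1).re, Prod.ext hfst (by linear_combination hfst + hsub)⟩

theorem quot_mk_eq_of_symTransInvariant_eq {p q : ℂ × ℂ}
    (h : symTransInvariant p = symTransInvariant q) :
    Quot.mk SymTransRel p = Quot.mk SymTransRel q := by
  simp only [symTransInvariant, Prod.mk.injEq] at h
  obtain ⟨him, hsq⟩ := h
  rcases sq_eq_sq_iff_eq_or_eq_neg.mp hsq with hsub | hsub
  · exact Quot.sound (SymTransRel.of_sub_eq him hsub)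
  · have hswap : SymTransRel q (q.2, q.1) := Or.inl rfl
    rw [Quot.sound hswap]
    refine Quot.sound (SymTransRel.of_sub_eq ?_ ?_)
    · rw [him, add_comm]
    · rw [hsub, neg_sub]

/-- The invariants descend to a homeomorphism from the quotient. -/
theorem isHomeomorph_lift_symTransInvariant :
    IsHomeomorph (Quot.lift symTransInvariant fun _ _ h => SymTransRel.symTransInvariant_eq h :
      Quot SymTransRel → ℝ × ℂ) where
  continuous := continuous_quot_lift _ continuous_symTransInvariant
  isOpenMap U hU := by
    rw [← Set.image_preimage_eq U Quot.mk_surjective, Set.image_image]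
    exact isOpenMap_symTransInvariant _ (hU.preimage continuous_quot_mk)
  bijective := by
    refine ⟨?_, fun y => ?_⟩
    · rintro ⟨p⟩ ⟨q⟩ h
      exact quot_mk_eq_of_symTransInvariant_eq h
    · obtain ⟨p, hp⟩ := symTransInvariant_surjective y
      exact ⟨Quot.mk _ p, hp⟩

/-- The quotient of the symmetric square of `ℂ` by simultaneous
translation of the real parts, i.e. the quotient of `ℂ × ℂ` by the equivalence
relation generated by `(z₁, z₂) ∼ (z₂, z₁)` and `(z₁, z₂) ∼ (z₁ + t, z₂ + t)` for
`t ∈ ℝ`, is homeomorphic to `ℝ³`. -/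
theorem stmt_16 : Nonempty (Quot SymTransRel ≃ₜ (Fin 3 → ℝ)) := by
  have hrank : Module.finrank ℝ (ℝ × ℂ) = Module.finrank ℝ (Fin 3 → ℝ) := by
    simp [Complex.finrank_real_complex]
  exact ⟨(isHomeomorph_lift_symTransInvariant.homeomorph _).trans
    (ContinuousLinearEquiv.ofFinrankEq hrank).toHomeomorph⟩
end
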